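/- arXiv:2006.10542 — 4 statements merged into one kernel-verified Lean document; each statement's English description precedes it below -/
import Mathlib

section
/- Let n ≥ 2 and let F = α + β be a Randers metric on a nonempty open set U ⊆ ℝⁿ. Then F is of isotropic S-curvature with S(x,y) = (n+1) c(x) F(x,y) for a smooth function c : U → ℝ if and only if e₀₀(x,y) = 2 c(x) (α(x,y)² − β(x,y)²) for all (x,y) ∈ U × ℝⁿ. -/
open MeasureTheory Matrix

noncomputable section

/-- `Vec n` is ℝⁿ. -/
abbrev Vec (n : ℕ) := Fin n → ℝ

/-- Partial derivative of `f` in the `i`-th coordinate direction at `x`. -/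
noncomputable def pd {n : ℕ} (i : Fin n) (f : Vec n → ℝ) (x : Vec n) : ℝ :=
  fderiv ℝ f x (Pi.single i 1)

/-- Partial derivative in the `i`-th `y`-coordinate of a function of `(x, y)`. -/
noncomputable def dy {n : ℕ} (i : Fin n) (f : Vec n → Vec n → ℝ) (x y : Vec n) : ℝ :=
  pd i (f x) y

/-- Partial derivative in the `i`-th `x`-coordinate of a function of `(x, y)`. -/
noncomputable def dx {n : ℕ} (i : Fin n) (f : Vec n → Vec n → ℝ) (x y : Vec n) : ℝ :=
  pd i (fun x' => f x' y) x

/-- The square `F²` of a metric function. -/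
noncomputable def F2 {n : ℕ} (F : Vec n → Vec n → ℝ) : Vec n → Vec n → ℝ :=
  fun x y => (F x y) ^ 2

/-- The fundamental tensor `g_{ij}(x,y) = ½ ∂²(F²)/∂yⁱ∂yʲ`. -/
noncomputable def gmat {n : ℕ} (F : Vec n → Vec n → ℝ) (x y : Vec n) :
    Matrix (Fin n) (Fin n) ℝ :=
  Matrix.of fun i j => (1 / 2) * dy i (fun x' y' => dy j (F2 F) x' y') x y

/-- The inverse fundamental tensor `(g^{ij})`. -/
noncomputable def ginv {n : ℕ} (F : Vec n → Vec n → ℝ) (x y : Vec n) :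
    Matrix (Fin n) (Fin n) ℝ :=
  (gmat F x y)⁻¹

/-- The geodesic coefficients
`Gⁱ = ¼ g^{il} (∂²(F²)/∂x^m∂y^l · y^m − ∂(F²)/∂x^l)`. -/
noncomputable def Geo {n : ℕ} (F : Vec n → Vec n → ℝ) (i : Fin n) (x y : Vec n) : ℝ :=
  (1 / 4) * ∑ l, ginv F x y i l *
    ((∑ m, dx m (fun x' y' => dy l (F2 F) x' y') x y * y m) - dx l (F2 F) x y)

/-- The Riemann curvature
`Rⁱ_k = 2 ∂Gⁱ/∂x^k − ∂²Gⁱ/∂x^j∂y^k y^j + 2 G^j ∂²Gⁱ/∂y^j∂y^k − ∂Gⁱ/∂y^j ∂G^j/∂y^k`. -/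
noncomputable def Riem {n : ℕ} (F : Vec n → Vec n → ℝ) (i k : Fin n) (x y : Vec n) : ℝ :=
  2 * dx k (Geo F i) x y
    - (∑ j, dy k (fun x' y' => dx j (Geo F i) x' y') x y * y j)
    + 2 * ∑ j, Geo F j x y * dy j (fun x' y' => dy k (Geo F i) x' y') x y
    - ∑ j, dy j (Geo F i) x y * dy k (Geo F j) x y

/-- The Ricci curvature `Ric = R^m_m`. -/
noncomputable def RicciC {n : ℕ} (F : Vec n → Vec n → ℝ) (x y : Vec n) : ℝ :=
  ∑ m, Riem F m m x y

/-- The Ricci curvature tensor `Ric_{ij} = ½ ∂²Ric/∂yⁱ∂yʲ`. -/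
noncomputable def RicciTensor {n : ℕ} (F : Vec n → Vec n → ℝ) (i j : Fin n)
    (x y : Vec n) : ℝ :=
  (1 / 2) * dy i (fun x' y' => dy j (RicciC F) x' y') x y

/-- The Akbar-Zadeh scalar curvature `r = g^{ij} Ric_{ij}`. -/
noncomputable def scalarCurv {n : ℕ} (F : Vec n → Vec n → ℝ) (x y : Vec n) : ℝ :=
  ∑ i, ∑ j, ginv F x y i j * RicciTensor F i j x y

/-- The Busemann-Hausdorff volume coefficient
`σ_BH(x) = Vol(𝔹ⁿ) / Vol {y | F(x,y) < 1}`. -/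
noncomputable def sigmaBH {n : ℕ} (F : Vec n → Vec n → ℝ) (x : Vec n) : ℝ :=
  (volume {y : Vec n | ∑ i, (y i) ^ 2 < 1}).toReal /
    (volume {y : Vec n | F x y < 1}).toReal

/-- The S-curvature `S(x,y) = ∂G^m/∂y^m − y^m ∂/∂x^m (ln σ_BH)`. -/
noncomputable def SCurv {n : ℕ} (F : Vec n → Vec n → ℝ) (x y : Vec n) : ℝ :=
  (∑ m, dy m (Geo F m) x y) - ∑ m, y m * pd m (fun x' => Real.log (sigmaBH F x')) x

/-- `F` is a Finsler metric on the open set `U ⊆ ℝⁿ`: it is smooth and positive on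
`U × (ℝⁿ \ {0})`, positively 1-homogeneous in `y`, and its fundamental tensor is
positive definite. -/
def IsFinslerOn {n : ℕ} (F : Vec n → Vec n → ℝ) (U : Set (Vec n)) : Prop :=
  ContDiffOn ℝ (⊤ : ℕ∞) (fun p : Vec n × Vec n => F p.1 p.2)
    (U ×ˢ {y : Vec n | y ≠ 0}) ∧
  ∀ x ∈ U, ∀ y : Vec n, y ≠ 0 →
    0 < F x y ∧ (∀ t : ℝ, 0 < t → F x (t • y) = t * F x y) ∧ (gmat F x y).PosDef

/-- The Riemannian part `α(x,y) = √(a_{ij}(x) yⁱ yʲ)` of a Randers metric. -/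
noncomputable def ralpha {n : ℕ} (a : Vec n → Matrix (Fin n) (Fin n) ℝ)
    (x y : Vec n) : ℝ :=
  Real.sqrt (∑ i, ∑ j, a x i j * y i * y j)

/-- The 1-form part `β(x,y) = b_i(x) yⁱ` of a Randers metric. -/
noncomputable def rbeta {n : ℕ} (b : Vec n → Vec n) (x y : Vec n) : ℝ :=
  ∑ i, b x i * y i

/-- `b(x)² = a^{ij}(x) b_i(x) b_j(x)`, the square of the α-norm of β. -/
noncomputable def bnormsq {n : ℕ} (a : Vec n → Matrix (Fin n) (Fin n) ℝ)
    (b : Vec n → Vec n) (x : Vec n) : ℝ :=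
  ∑ i, ∑ j, (a x)⁻¹ i j * b x i * b x j

/-- The data `(a, b)` defines a Randers metric `F = α + β` on `U`:
`a` is a smooth field of symmetric positive definite matrices, `b` is a smooth
field of covectors with `‖β‖_α < 1`, and `F = α + β` is a Finsler metric on `U`. -/
def IsRandersOn {n : ℕ} (a : Vec n → Matrix (Fin n) (Fin n) ℝ) (b : Vec n → Vec n)
    (U : Set (Vec n)) : Prop :=
  (∀ i j, ContDiffOn ℝ (⊤ : ℕ∞) (fun x => a x i j) U) ∧
  ContDiffOn ℝ (⊤ : ℕ∞) b U ∧
  (∀ x ∈ U, (a x).IsSymm ∧ (a x).PosDef ∧ bnormsq a b x < 1) ∧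
  IsFinslerOn (fun x y => ralpha a x y + rbeta b x y) U

/-- Christoffel symbols `γ^k_{ij}` of the Riemannian metric `α` given by `a`. -/
noncomputable def christoffel {n : ℕ} (a : Vec n → Matrix (Fin n) (Fin n) ℝ)
    (k i j : Fin n) (x : Vec n) : ℝ :=
  (1 / 2) * ∑ l, (a x)⁻¹ k l *
    (pd i (fun x' => a x' l j) x + pd j (fun x' => a x' i l) x
      - pd l (fun x' => a x' i j) x)

/-- Covariant derivative `b_{i;j}` of the 1-form `β` with respect to `α`. -/
noncomputable def bcov {n : ℕ} (a : Vec n → Matrix (Fin n) (Fin n) ℝ)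
    (b : Vec n → Vec n) (i j : Fin n) (x : Vec n) : ℝ :=
  pd j (fun x' => b x' i) x - ∑ k, b x k * christoffel a k i j x

/-- `r_{ij} = ½ (b_{i;j} + b_{j;i})`. -/
noncomputable def rten {n : ℕ} (a : Vec n → Matrix (Fin n) (Fin n) ℝ)
    (b : Vec n → Vec n) (i j : Fin n) (x : Vec n) : ℝ :=
  (1 / 2) * (bcov a b i j x + bcov a b j i x)

/-- `s_{ij} = ½ (b_{i;j} − b_{j;i})`. -/
noncomputable def sten {n : ℕ} (a : Vec n → Matrix (Fin n) (Fin n) ℝ)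
    (b : Vec n → Vec n) (i j : Fin n) (x : Vec n) : ℝ :=
  (1 / 2) * (bcov a b i j x - bcov a b j i x)

/-- `b^i = a^{ik} b_k`. -/
noncomputable def bup {n : ℕ} (a : Vec n → Matrix (Fin n) (Fin n) ℝ)
    (b : Vec n → Vec n) (i : Fin n) (x : Vec n) : ℝ :=
  ∑ k, (a x)⁻¹ i k * b x k

/-- `s_j = b^i s_{ij}`. -/
noncomputable def slow {n : ℕ} (a : Vec n → Matrix (Fin n) (Fin n) ℝ)
    (b : Vec n → Vec n) (j : Fin n) (x : Vec n) : ℝ :=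
  ∑ i, bup a b i x * sten a b i j x

/-- `e₀₀(x,y) = (r_{ij} + b_i s_j + b_j s_i) yⁱ yʲ`. -/
noncomputable def e00 {n : ℕ} (a : Vec n → Matrix (Fin n) (Fin n) ℝ)
    (b : Vec n → Vec n) (x y : Vec n) : ℝ :=
  ∑ i, ∑ j,
    (rten a b i j x + b x i * slow a b j x + b x j * slow a b i x) * y i * y j


section PdCalc
variable {n : ℕ}

lemma pd_congr {i : Fin n} {f g : Vec n → ℝ} {x : Vec n} (h : f =ᶠ[nhds x] g) :
    pd i f x = pd i g x := by
  unfold pd; rw [h.fderiv_eq]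

lemma pd_add' {i : Fin n} {f g : Vec n → ℝ} {x : Vec n} (hf : DifferentiableAt ℝ f x)
    (hg : DifferentiableAt ℝ g x) : pd i (fun z => f z + g z) x = pd i f x + pd i g x := by
  unfold pd; rw [fderiv_fun_add hf hg]; rfl

lemma pd_sub' {i : Fin n} {f g : Vec n → ℝ} {x : Vec n} (hf : DifferentiableAt ℝ f x)
    (hg : DifferentiableAt ℝ g x) : pd i (fun z => f z - g z) x = pd i f x - pd i g x := by
  unfold pd; rw [fderiv_fun_sub hf hg]; rfl

lemma pd_mul' {i : Fin n} {f g : Vec n → ℝ} {x : Vec n} (hf : DifferentiableAt ℝ f x)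
    (hg : DifferentiableAt ℝ g x) :
    pd i (fun z => f z * g z) x = pd i f x * g x + f x * pd i g x := by
  unfold pd; rw [fderiv_fun_mul hf hg]
  simp; ring

lemma pd_const' {i : Fin n} {c : ℝ} {x : Vec n} : pd i (fun _ => c) x = 0 := by
  unfold pd; simp

lemma pd_sum' {ι : Type*} {i : Fin n} {s : Finset ι} {f : ι → Vec n → ℝ} {x : Vec n}
    (hf : ∀ k ∈ s, DifferentiableAt ℝ (f k) x) :
    pd i (fun z => ∑ k ∈ s, f k z) x = ∑ k ∈ s, pd i (f k) x := by
  unfold pd; rw [fderiv_fun_sum hf]; simp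

lemma pd_coord {i j : Fin n} {x : Vec n} : pd i (fun z => z j) x = if i = j then 1 else 0 := by
  unfold pd
  have : HasFDerivAt (fun z : Vec n => z j) (ContinuousLinearMap.proj (R := ℝ) j) x :=
    (ContinuousLinearMap.proj (R := ℝ) (φ := fun _ : Fin n => ℝ) j).hasFDerivAt
  rw [this.fderiv]
  simp [Pi.single_apply, eq_comm]

/-- chain rule with a one-variable function -/
lemma pd_comp' {i : Fin n} {f : Vec n → ℝ} {φ : ℝ → ℝ} {φ' : ℝ} {x : Vec n}
    (hφ : HasDerivAt φ φ' (f x)) (hf : DifferentiableAt ℝ f x) :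
    pd i (fun z => φ (f z)) x = φ' * pd i f x := by
  unfold pd
  have := (hφ.comp_hasFDerivAt x hf.hasFDerivAt).fderiv
  have h2 : (φ ∘ f) = fun z => φ (f z) := rfl
  rw [← h2, this]; simp

lemma pd_sqrt' {i : Fin n} {f : Vec n → ℝ} {x : Vec n} (hf : DifferentiableAt ℝ f x)
    (h0 : f x ≠ 0) :
    pd i (fun z => Real.sqrt (f z)) x = pd i f x / (2 * Real.sqrt (f x)) := by
  rw [pd_comp' (Real.hasDerivAt_sqrt h0) hf]; ring

lemma pd_log' {i : Fin n} {f : Vec n → ℝ} {x : Vec n} (hf : DifferentiableAt ℝ f x)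
    (h0 : f x ≠ 0) :
    pd i (fun z => Real.log (f z)) x = pd i f x / f x := by
  rw [pd_comp' (Real.hasDerivAt_log h0) hf]; field_simp

lemma pd_inv' {i : Fin n} {f : Vec n → ℝ} {x : Vec n} (hf : DifferentiableAt ℝ f x)
    (h0 : f x ≠ 0) :
    pd i (fun z => (f z)⁻¹) x = - pd i f x / (f x)^2 := by
  rw [pd_comp' (hasDerivAt_inv h0) hf]; field_simp

lemma pd_div' {i : Fin n} {f g : Vec n → ℝ} {x : Vec n} (hf : DifferentiableAt ℝ f x)
    (hg : DifferentiableAt ℝ g x) (h0 : g x ≠ 0) :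
    pd i (fun z => f z / g z) x = pd i f x / g x - f x * pd i g x / (g x)^2 := by
  simp only [div_eq_mul_inv]
  rw [pd_mul' hf (hg.fun_inv h0), pd_inv' hg h0]; ring

lemma sum_pd_eq_fderiv {f : Vec n → ℝ} {x y : Vec n} :
    ∑ m, y m * pd m f x = fderiv ℝ f x y := by
  conv_rhs => rw [pi_eq_sum_univ' y]
  simp only [map_sum, map_smul, smul_eq_mul, pd]

/-- Euler's identity -/
lemma euler_one {f : Vec n → ℝ} {y : Vec n} (hf : DifferentiableAt ℝ f y)
    (h : ∀ t : ℝ, 0 < t → f (t • y) = t * f y) : ∑ m, y m * pd m f y = f y := by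
  rw [sum_pd_eq_fderiv]
  have h1 : HasDerivAt (fun t : ℝ => t • y) y 1 := by
    simpa using (hasDerivAt_id (1:ℝ)).smul_const y
  have hf' : HasFDerivAt f (fderiv ℝ f y) ((fun t : ℝ => t • y) 1) := by
    simpa using hf.hasFDerivAt
  have h2 := hf'.comp_hasDerivAt (1:ℝ) h1
  have h3 : HasDerivAt (fun t : ℝ => t * f y) (f y) 1 := by
    simpa using (hasDerivAt_id (1:ℝ)).mul_const (f y)
  have h4 : (f ∘ fun t : ℝ => t • y) =ᶠ[nhds 1] fun t => t * f y := by
    filter_upwards [lt_mem_nhds (zero_lt_one' ℝ)] with t ht using h t ht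
  exact h2.unique (h3.congr_of_eventuallyEq h4)

end PdCalc

section DetCalc
variable {n : ℕ}

lemma differentiableAt_det {A : Vec n → Matrix (Fin n) (Fin n) ℝ} {x : Vec n}
    (hA : ∀ i j, DifferentiableAt ℝ (fun z => A z i j) x) :
    DifferentiableAt ℝ (fun z => (A z).det) x := by
  simp only [Matrix.det_apply']
  fun_prop

lemma pd_prod' {ι : Type*} [DecidableEq ι] {i : Fin n} {s : Finset ι} {f : ι → Vec n → ℝ}
    {x : Vec n} (hf : ∀ k ∈ s, DifferentiableAt ℝ (f k) x) :
    pd i (fun z => ∏ k ∈ s, f k z) x = ∑ k ∈ s, (∏ l ∈ s.erase k, f l x) * pd i (f k) x := by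
  unfold pd
  have := (HasFDerivAt.finsetProd (u := s) (g := f) (x := x)
    (fun k hk => (hf k hk).hasFDerivAt)).fderiv
  rw [this]; simp

lemma pd_det {A : Vec n → Matrix (Fin n) (Fin n) ℝ} {x : Vec n} {m : Fin n}
    (hA : ∀ i j, DifferentiableAt ℝ (fun z => A z i j) x) :
    pd m (fun z => (A z).det) x =
      ∑ i, ∑ j, (A x).adjugate i j * pd m (fun z => A z j i) x := by
  have key : ∀ i, ∑ j, (A x).adjugate i j * pd m (fun z => A z j i) x =
      ((A x).updateCol i (fun j => pd m (fun z => A z j i) x)).det := by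
    intro i
    rw [← Matrix.cramer_apply, Matrix.cramer_eq_adjugate_mulVec]; rfl
  simp only [key]
  simp only [Matrix.det_apply']
  rw [pd_sum' (by intros; fun_prop), Finset.sum_comm]
  refine Finset.sum_congr rfl fun σ _ => ?_
  rw [pd_mul' (by fun_prop) (by fun_prop), pd_const', pd_prod' (by intros; fun_prop),
    zero_mul, zero_add, Finset.mul_sum]
  refine Finset.sum_congr rfl fun i _ => ?_
  congr 1
  rw [← Finset.mul_prod_erase Finset.univ _ (Finset.mem_univ i), mul_comm]
  congr 1
  · simp
  · refine Finset.prod_congr rfl fun k hk => ?_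
    rw [Matrix.updateCol_ne (Finset.ne_of_mem_erase hk)]

lemma differentiableAt_inv_entry {A : Vec n → Matrix (Fin n) (Fin n) ℝ} {x : Vec n}
    (hA : ∀ i j, DifferentiableAt ℝ (fun z => A z i j) x) (h0 : (A x).det ≠ 0) (i j : Fin n) :
    DifferentiableAt ℝ (fun z => (A z)⁻¹ i j) x := by
  have : ∀ z, (A z)⁻¹ i j = (A z).det⁻¹ * ((A z).updateRow j (Pi.single i 1)).det := by
    intro z; rw [Matrix.inv_def, ← Matrix.adjugate_apply]; simp
  simp only [this]
  refine ((differentiableAt_det hA).inv h0).mul (differentiableAt_det ?_)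
  intro k l
  by_cases h : k = j
  · subst h; simp
  · simp only [Matrix.updateRow_ne h]; exact hA k l

/-- derivative of `w ⬝ A⁻¹ w` -/
lemma pd_quad_inv {A : Vec n → Matrix (Fin n) (Fin n) ℝ} {w : Vec n → Vec n} {x : Vec n}
    {m : Fin n} (hA : ∀ i j, DifferentiableAt ℝ (fun z => A z i j) x)
    (hw : ∀ i, DifferentiableAt ℝ (fun z => w z i) x)
    (h0 : (A x).det ≠ 0) (hs : (A x).IsSymm) :
    pd m (bnormsq A w) x = 2 * ∑ i, bup A w i x * pd m (fun z => w z i) x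
      - ∑ i, ∑ j, bup A w i x * bup A w j x * pd m (fun z => A z i j) x := by
  have hI := differentiableAt_inv_entry hA h0
  have hb : ∀ i, DifferentiableAt ℝ (fun z => bup A w i z) x := by
    intro i; unfold bup
    exact DifferentiableAt.fun_sum fun k _ => (hI i k).mul (hw k)
  have hdet : ∀ᶠ z in nhds x, (A z).det ≠ 0 :=
    (differentiableAt_det hA).continuousAt.eventually_ne h0
  -- w = A bup
  have e1 : ∀ z, (A z).det ≠ 0 → ∀ i, w z i = ∑ j, A z i j * bup A w j z := by
    intro z hz i
    have : (fun j => bup A w j z) = (A z)⁻¹ *ᵥ w z := rfl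
    have h2 : A z *ᵥ (fun j => bup A w j z) = w z := by
      rw [this, Matrix.mulVec_mulVec, Matrix.mul_nonsing_inv _ (isUnit_iff_ne_zero.2 hz)]; simp
    exact (congrFun h2 i).symm
  have e2 : ∀ i, pd m (fun z => w z i) x =
      ∑ j, (pd m (fun z => A z i j) x * bup A w j x + A x i j * pd m (fun z => bup A w j z) x) := by
    intro i
    have : (fun z => w z i) =ᶠ[nhds x] fun z => ∑ j, A z i j * bup A w j z := by
      filter_upwards [hdet] with z hz using e1 z hz i
    rw [pd_congr this, pd_sum' (by intros; fun_prop)]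
    refine Finset.sum_congr rfl fun j _ => pd_mul' (by fun_prop) (by fun_prop)
  have e3 : ∀ z, bnormsq A w z = ∑ i, bup A w i z * w z i := by
    intro z; unfold bnormsq bup
    simp only [Finset.sum_mul]
    refine Finset.sum_congr rfl fun i _ => Finset.sum_congr rfl fun j _ => ?_
    ring
  have e4 : ∀ j, ∑ i, bup A w i x * A x i j = w x j := by
    intro j
    rw [e1 x h0 j]
    refine Finset.sum_congr rfl fun i _ => ?_
    rw [hs.apply]; ring
  have e5 : ∑ i, bup A w i x * pd m (fun z => w z i) x =
      (∑ i, ∑ j, bup A w i x * bup A w j x * pd m (fun z => A z i j) x) +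
      ∑ j, pd m (fun z => bup A w j z) x * w x j := by
    have : ∀ j, pd m (fun z => bup A w j z) x * w x j =
        ∑ i, bup A w i x * A x i j * pd m (fun z => bup A w j z) x := by
      intro j; rw [← e4 j, Finset.mul_sum]
      refine Finset.sum_congr rfl fun i _ => by ring
    simp only [this]
    rw [Finset.sum_comm (f := fun j i => bup A w i x * A x i j * pd m (fun z => bup A w j z) x),
      ← Finset.sum_add_distrib]
    refine Finset.sum_congr rfl fun i _ => ?_
    rw [e2 i, Finset.mul_sum, ← Finset.sum_add_distrib]
    refine Finset.sum_congr rfl fun j _ => by ring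
  have e6 : pd m (bnormsq A w) x = ∑ i, (pd m (fun z => bup A w i z) x * w x i +
      bup A w i x * pd m (fun z => w z i) x) := by
    have : bnormsq A w = fun z => ∑ i, bup A w i z * w z i := funext e3
    rw [this, pd_sum' (fun i _ => (hb i).fun_mul (hw i))]
    exact Finset.sum_congr rfl fun i _ => pd_mul' (hb i) (hw i)
  rw [e6, Finset.sum_add_distrib]
  linarith
end DetCalc


section Vol
variable {n : ℕ}

lemma quad_eq (a : Matrix (Fin n) (Fin n) ℝ) (y : Vec n) :
    ∑ i, ∑ j, a i j * y i * y j = y ⬝ᵥ (a *ᵥ y) := by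
  simp only [dotProduct, Matrix.mulVec, Finset.mul_sum]
  exact Finset.sum_congr rfl fun i _ => Finset.sum_congr rfl fun j _ => by ring

lemma quad_add {a : Matrix (Fin n) (Fin n) ℝ} (hs : a.IsSymm) (y u : Vec n) (t : ℝ) :
    (y + t • u) ⬝ᵥ (a *ᵥ (y + t • u)) = y ⬝ᵥ (a *ᵥ y) + 2 * t * (y ⬝ᵥ (a *ᵥ u))
      + t ^ 2 * (u ⬝ᵥ (a *ᵥ u)) := by
  have : u ⬝ᵥ (a *ᵥ y) = y ⬝ᵥ (a *ᵥ u) := by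
    rw [Matrix.dotProduct_mulVec, ← Matrix.mulVec_transpose, hs.eq, dotProduct_comm]
  simp only [Matrix.mulVec_add, Matrix.mulVec_smul, add_dotProduct, dotProduct_add,
    smul_dotProduct, dotProduct_smul, smul_eq_mul, this]
  ring

lemma cauchy_aux {a : Matrix (Fin n) (Fin n) ℝ} (hs : a.IsSymm) (hp : a.PosDef) (b u : Vec n)
    (hu : a *ᵥ u = b) (y : Vec n) :
    (b ⬝ᵥ y) ^ 2 * (2 - b ⬝ᵥ u) ≤ y ⬝ᵥ (a *ᵥ y) := by
  have h := hp.posSemidef.dotProduct_mulVec_nonneg (y + (-(b ⬝ᵥ y)) • u)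
  simp only [star_trivial] at h
  rw [quad_add hs, hu, dotProduct_comm y b, dotProduct_comm u b] at h
  nlinarith

lemma pos_quad {a : Matrix (Fin n) (Fin n) ℝ} (hp : a.PosDef) {y : Vec n} (hy : y ≠ 0) :
    0 < y ⬝ᵥ (a *ᵥ y) := by
  simpa using hp.dotProduct_mulVec_pos hy

lemma exists_u {a : Matrix (Fin n) (Fin n) ℝ} (hp : a.PosDef) (b : Vec n) :
    a *ᵥ (a⁻¹ *ᵥ b) = b := by
  rw [Matrix.mulVec_mulVec, Matrix.mul_nonsing_inv _ (isUnit_iff_ne_zero.2 hp.det_pos.ne')]; simp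

lemma strict_aux {a : Matrix (Fin n) (Fin n) ℝ} (hs : a.IsSymm) (hp : a.PosDef) (b u : Vec n)
    (hu : a *ᵥ u = b) (hb : b ⬝ᵥ u < 1) {y : Vec n} (hy : y ≠ 0) :
    (b ⬝ᵥ y) ^ 2 < y ⬝ᵥ (a *ᵥ y) := by
  have h1 := cauchy_aux hs hp b u hu y
  have h2 := pos_quad hp hy
  by_cases h : b ⬝ᵥ y = 0
  · rw [h]; simpa using h2
  · have : 0 < (b ⬝ᵥ y) ^ 2 := by positivity
    nlinarith

lemma quad_sub_vecMulVec (a : Matrix (Fin n) (Fin n) ℝ) (b y z : Vec n) :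
    y ⬝ᵥ ((a - vecMulVec b b) *ᵥ z) = y ⬝ᵥ (a *ᵥ z) - (b ⬝ᵥ y) * (b ⬝ᵥ z) := by
  rw [Matrix.sub_mulVec, dotProduct_sub, Matrix.vecMulVec_mulVec]
  simp [dotProduct_comm y b, mul_comm]

lemma set_aux {a : Matrix (Fin n) (Fin n) ℝ} (hs : a.IsSymm) (hp : a.PosDef) (b u : Vec n)
    (hu : a *ᵥ u = b) (hb : b ⬝ᵥ u < 1) (y : Vec n) :
    Real.sqrt (y ⬝ᵥ (a *ᵥ y)) + b ⬝ᵥ y < 1 ↔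
      (y + (1 - b ⬝ᵥ u)⁻¹ • u) ⬝ᵥ (((1 - b ⬝ᵥ u) • (a - vecMulVec b b)) *ᵥ
        (y + (1 - b ⬝ᵥ u)⁻¹ • u)) < 1 := by
  have hq : 0 < 1 - b ⬝ᵥ u := by linarith
  have hA : 0 ≤ y ⬝ᵥ (a *ᵥ y) := by simpa using hp.posSemidef.dotProduct_mulVec_nonneg y
  have h1 := cauchy_aux hs hp b u hu y
  rw [Matrix.smul_mulVec, dotProduct_smul, quad_sub_vecMulVec, quad_add hs, hu, dotProduct_add,
    dotProduct_smul, dotProduct_comm y b, dotProduct_comm u b, smul_eq_mul, smul_eq_mul]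
  set B := b ⬝ᵥ y
  set A := y ⬝ᵥ (a *ᵥ y)
  set p := b ⬝ᵥ u
  have e : (1 - p) * (A + 2 * (1 - p)⁻¹ * B + (1 - p)⁻¹ ^ 2 * p -
      (B + (1 - p)⁻¹ * p) * (B + (1 - p)⁻¹ * p)) = (1 - p) * (A - B ^ 2 + 2 * B) + p := by
    field_simp; ring
  rw [e]
  have e2 : (1 - p) * (A - B ^ 2 + 2 * B) + p < 1 ↔ A < (1 - B) ^ 2 := by
    constructor
    · intro h
      by_contra hc
      nlinarith [mul_le_mul_of_nonneg_left (not_lt.1 hc) hq.le]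
    · intro h
      nlinarith [mul_lt_mul_of_pos_left h hq]
  rw [e2]
  have hsq := Real.sq_sqrt hA
  have hsn := Real.sqrt_nonneg A
  constructor
  · intro h
    nlinarith
  · intro h
    have hB : B < 1 := by
      by_contra hc
      nlinarith
    nlinarith [abs_lt_of_sq_lt_sq (show (Real.sqrt A)^2 < (1 - B)^2 by rw [hsq]; exact h) (by linarith), le_abs_self (Real.sqrt A)]

lemma det_aux {a : Matrix (Fin n) (Fin n) ℝ} (hp : a.PosDef) (b : Vec n) :
    ((1 - b ⬝ᵥ (a⁻¹ *ᵥ b)) • (a - vecMulVec b b)).det =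
      a.det * (1 - b ⬝ᵥ (a⁻¹ *ᵥ b)) ^ (n + 1) := by
  rw [Matrix.det_smul]
  have : a - vecMulVec b b = a + replicateCol Unit b * replicateRow Unit (-b) := by
    rw [sub_eq_add_neg, ← Matrix.vecMulVec_eq, Matrix.vecMulVec_neg]
  rw [this, Matrix.det_add_replicateCol_mul_replicateRow (isUnit_iff_ne_zero.2 hp.det_pos.ne')]
  rw [Matrix.det_unique (n := Unit)]
  have : (replicateRow Unit (-b) * a⁻¹ * replicateCol Unit b) default default
    = - (b ⬝ᵥ (a⁻¹ *ᵥ b)) := by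
    rw [Matrix.mul_assoc]
    simp [Matrix.mul_apply, dotProduct, Matrix.mulVec]
  rw [Matrix.add_apply, this]
  simp; ring

lemma ball_vol_pos : 0 < (volume {y : Vec n | ∑ i, (y i) ^ 2 < 1}).toReal := by
  have ho : IsOpen {y : Vec n | ∑ i, (y i) ^ 2 < 1} := isOpen_lt (by fun_prop) (by fun_prop)
  refine ENNReal.toReal_pos (ho.measure_pos volume ⟨0, by simp⟩).ne' ?_
  refine ((Metric.isBounded_closedBall (x := (0 : Vec n)) (r := 1)).subset ?_).measure_lt_top.ne
  intro y hy
  rw [mem_closedBall_zero_iff, pi_norm_le_iff_of_nonneg zero_le_one]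
  intro i
  have h1 : (y i)^2 ≤ ∑ i, (y i) ^ 2 :=
    Finset.single_le_sum (f := fun i => (y i)^2) (fun _ _ => sq_nonneg _) (Finset.mem_univ i)
  have h2 : ∑ i, (y i) ^ 2 < 1 := hy
  rw [Real.norm_eq_abs]
  exact (sq_le_one_iff_abs_le_one _).1 (by linarith)

section
open scoped MatrixOrder
lemma psd_factor {M : Matrix (Fin n) (Fin n) ℝ} (hM : M.PosSemidef) :
    ∃ B : Matrix (Fin n) (Fin n) ℝ, M = Bᵀ * B := by
  obtain ⟨B, hB⟩ := CStarAlgebra.nonneg_iff_eq_star_mul_self.mp hM.nonneg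
  refine ⟨B, ?_⟩
  rw [hB, Matrix.star_eq_conjTranspose, Matrix.conjTranspose_eq_transpose_of_trivial]
end

lemma vol_randers {a : Matrix (Fin n) (Fin n) ℝ} (hs : a.IsSymm) (hp : a.PosDef) (b : Vec n)
    (hb : b ⬝ᵥ (a⁻¹ *ᵥ b) < 1) :
    ∃ D : ℝ, 0 < D ∧ D ^ 2 = a.det * (1 - b ⬝ᵥ (a⁻¹ *ᵥ b)) ^ (n + 1) ∧
      (volume {y : Vec n | Real.sqrt (y ⬝ᵥ (a *ᵥ y)) + b ⬝ᵥ y < 1}).toReal =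
       D⁻¹ * (volume {y : Vec n | ∑ i, (y i) ^ 2 < 1}).toReal := by
  have hu := exists_u hp b
  have hq : 0 < 1 - b ⬝ᵥ (a⁻¹ *ᵥ b) := by linarith
  have hM : ((1 - b ⬝ᵥ (a⁻¹ *ᵥ b)) • (a - vecMulVec b b)).PosSemidef := by
    refine Matrix.PosSemidef.of_dotProduct_mulVec_nonneg ?_ ?_
    · rw [Matrix.IsHermitian, Matrix.conjTranspose_eq_transpose_of_trivial]
      ext i j
      simp [hs.apply, Matrix.vecMulVec_apply, mul_comm]
    · intro y
      rw [star_trivial, Matrix.smul_mulVec, dotProduct_smul, quad_sub_vecMulVec, smul_eq_mul]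
      have := cauchy_aux hs hp b _ hu y
      refine mul_nonneg hq.le ?_
      nlinarith [mul_nonneg (sq_nonneg (b ⬝ᵥ y)) hq.le]
  obtain ⟨B, hB⟩ := psd_factor hM
  have hdet := det_aux hp b
  have hdet2 : B.det ^ 2 = a.det * (1 - b ⬝ᵥ (a⁻¹ *ᵥ b)) ^ (n + 1) := by
    rw [← hdet, hB, Matrix.det_mul, Matrix.det_transpose, sq]
  have hpos : 0 < B.det ^ 2 := by
    rw [hdet2]; exact mul_pos hp.det_pos (pow_pos hq _)
  have hB0 : B.det ≠ 0 := by
    intro h; rw [h] at hpos; simp at hpos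
  refine ⟨|B.det|, abs_pos.2 hB0, by rw [sq_abs, hdet2], ?_⟩
  have hset : {y : Vec n | Real.sqrt (y ⬝ᵥ (a *ᵥ y)) + b ⬝ᵥ y < 1} =
      (fun y => y + (1 - b ⬝ᵥ (a⁻¹ *ᵥ b))⁻¹ • (a⁻¹ *ᵥ b)) ⁻¹'
        ((Matrix.toLin' B) ⁻¹' {y : Vec n | ∑ i, (y i) ^ 2 < 1}) := by
    ext y
    simp only [Set.mem_ofPred_eq, Set.mem_preimage]
    rw [set_aux hs hp b _ hu hb y, hB, ← Matrix.mulVec_mulVec, Matrix.dotProduct_mulVec,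
      Matrix.vecMul_transpose, Matrix.toLin'_apply]
    simp [dotProduct, sq]
  have hd : LinearMap.det (Matrix.toLin' B) ≠ 0 := by simpa using hB0
  rw [hset, measure_preimage_add_right, Measure.addHaar_preimage_linearMap _ hd,
    ENNReal.toReal_mul, LinearMap.det_toLin']
  rw [ENNReal.toReal_ofReal (abs_nonneg _), abs_inv]

lemma bnormsq_eq (a : Vec n → Matrix (Fin n) (Fin n) ℝ) (b : Vec n → Vec n) (x : Vec n) :
    bnormsq a b x = b x ⬝ᵥ ((a x)⁻¹ *ᵥ b x) := quad_eq _ _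

lemma log_sigma {a : Vec n → Matrix (Fin n) (Fin n) ℝ} {b : Vec n → Vec n} {x : Vec n}
    {F : Vec n → Vec n → ℝ}
    (hFdef : ∀ x y, F x y = ralpha a x y + rbeta b x y)
    (hs : (a x).IsSymm) (hp : (a x).PosDef) (hb : bnormsq a b x < 1) :
    Real.log (sigmaBH F x) =
      (1/2) * Real.log (a x).det + ((n:ℝ)+1)/2 * Real.log (1 - bnormsq a b x) := by
  rw [bnormsq_eq] at hb ⊢
  obtain ⟨D, hD, hD2, hv⟩ := vol_randers hs hp (b x) hb
  have hset : {y : Vec n | F x y < 1} =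
      {y : Vec n | Real.sqrt (y ⬝ᵥ (a x *ᵥ y)) + b x ⬝ᵥ y < 1} := by
    ext y; simp only [Set.mem_ofPred_eq]
    rw [hFdef, ralpha, quad_eq]; rfl
  have hV := ball_vol_pos (n := n)
  have : sigmaBH F x = D := by
    rw [sigmaBH, hset, hv]; field_simp
  rw [this]
  have h2 : 2 * Real.log D = Real.log (D^2) := by rw [Real.log_pow]; norm_num
  rw [hD2, Real.log_mul hp.det_pos.ne' (pow_pos (by linarith) _).ne', Real.log_pow] at h2
  push_cast at h2
  linarith
end Vol


section LogSigma
variable {n : ℕ} {a : Vec n → Matrix (Fin n) (Fin n) ℝ} {b : Vec n → Vec n} {x : Vec n}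

lemma inv_symm (hs : (a x).IsSymm) (i j : Fin n) : (a x)⁻¹ i j = (a x)⁻¹ j i := by
  have : ((a x)⁻¹)ᵀ = (a x)⁻¹ := by rw [Matrix.transpose_nonsing_inv, hs.eq]
  exact congrFun (congrFun this j) i

lemma sum_christoffel (hs : (a x).IsSymm) (k : Fin n) :
    ∑ m, christoffel a m m k x = (1/2) * ∑ i, ∑ j, (a x)⁻¹ i j * pd k (fun z => a z i j) x := by
  unfold christoffel
  rw [← Finset.mul_sum]
  congr 1
  have e : ∑ m, ∑ l, (a x)⁻¹ m l * (pd m (fun z => a z l k) x) =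
      ∑ m, ∑ l, (a x)⁻¹ m l * (pd l (fun z => a z m k) x) := by
    rw [Finset.sum_comm]
    refine Finset.sum_congr rfl fun i _ => Finset.sum_congr rfl fun j _ => ?_
    rw [inv_symm hs]
  simp only [mul_sub, mul_add, Finset.sum_add_distrib, Finset.sum_sub_distrib]
  rw [e]; ring

lemma b_christoffel (hs : (a x).IsSymm) (i k : Fin n) :
    ∑ l, b x l * christoffel a l i k x = (1/2) * ∑ p, bup a b p x *
      (pd i (fun x' => a x' p k) x + pd k (fun x' => a x' i p) x
      - pd p (fun x' => a x' i k) x) := by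
  unfold christoffel bup
  simp only [Finset.mul_sum, Finset.sum_mul]
  rw [Finset.sum_comm]
  refine Finset.sum_congr rfl fun p _ => Finset.sum_congr rfl fun l _ => ?_
  rw [inv_symm hs l p]; ring

lemma bup_bcov (hs : (a x).IsSymm) (k : Fin n) :
    2 * ∑ i, bup a b i x * bcov a b i k x = 2 * ∑ i, bup a b i x * pd k (fun z => b z i) x
      - ∑ i, ∑ j, bup a b i x * bup a b j x * pd k (fun z => a z i j) x := by
  unfold bcov
  simp only [b_christoffel hs]
  have e : ∑ i, ∑ p, bup a b i x * bup a b p x * (pd i (fun z => a z p k) x) =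
      ∑ i, ∑ p, bup a b i x * bup a b p x * (pd p (fun z => a z i k) x) := by
    rw [Finset.sum_comm]
    refine Finset.sum_congr rfl fun i _ => Finset.sum_congr rfl fun j _ => ?_
    ring
  have e2 : ∀ i, bup a b i x * (pd k (fun z => b z i) x - 1 / 2 * ∑ p, bup a b p x *
      (pd i (fun x' => a x' p k) x + pd k (fun x' => a x' i p) x - pd p (fun x' => a x' i k) x))
      = bup a b i x * pd k (fun z => b z i) x - (1/2) *
      ((∑ p, bup a b i x * bup a b p x * (pd i (fun z => a z p k) x))
      + (∑ p, bup a b i x * bup a b p x * (pd k (fun z => a z i p) x))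
      - (∑ p, bup a b i x * bup a b p x * (pd p (fun z => a z i k) x))) := by
    intro i
    rw [← Finset.sum_add_distrib, ← Finset.sum_sub_distrib, mul_sub, Finset.mul_sum,
      Finset.mul_sum, Finset.mul_sum]
    congr 1
    refine Finset.sum_congr rfl fun p _ => by ring
  simp only [e2, Finset.sum_sub_distrib, ← Finset.mul_sum, Finset.sum_add_distrib, e]
  ring

lemma pd_log_sigma {F : Vec n → Vec n → ℝ} {U : Set (Vec n)} (hU : IsOpen U) (hx : x ∈ U)
    (hda : ∀ i j, DifferentiableAt ℝ (fun z => a z i j) x)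
    (hdb : ∀ i, DifferentiableAt ℝ (fun z => b z i) x)
    (hFdef : ∀ x y, F x y = ralpha a x y + rbeta b x y)
    (h : ∀ x ∈ U, (a x).IsSymm ∧ (a x).PosDef ∧ bnormsq a b x < 1) (k : Fin n) :
    pd k (fun x' => Real.log (sigmaBH F x')) x = ∑ m, christoffel a m m k x
      - ((n:ℝ)+1) * ((∑ i, bup a b i x * bcov a b i k x) / (1 - bnormsq a b x)) := by
  have hev : (fun x' => Real.log (sigmaBH F x')) =ᶠ[nhds x] fun x' =>
      (1/2) * Real.log (a x').det + ((n:ℝ)+1)/2 * Real.log (1 - bnormsq a b x') := by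
    filter_upwards [hU.mem_nhds hx] with z hz
    obtain ⟨h1, h2, h3⟩ := h z hz
    exact log_sigma hFdef h1 h2 h3
  obtain ⟨hs, hp, hb⟩ := h x hx
  have hd0 := hp.det_pos.ne'
  have hdd := differentiableAt_det hda
  have hI := differentiableAt_inv_entry hda hd0
  have hbn : DifferentiableAt ℝ (bnormsq a b) x := by
    unfold bnormsq
    exact DifferentiableAt.fun_sum fun i _ => DifferentiableAt.fun_sum fun j _ =>
      ((hI i j).mul (hdb i)).mul (hdb j)
  have hbn1 : DifferentiableAt ℝ (fun z => 1 - bnormsq a b z) x := hbn.const_sub 1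
  have hne : 1 - bnormsq a b x ≠ 0 := by linarith
  rw [pd_congr hev, pd_add' ((hdd.log hd0).const_mul _) ((hbn1.log hne).const_mul _),
    pd_mul' (by fun_prop) (hdd.log hd0), pd_mul' (by fun_prop) (hbn1.log hne),
    pd_const', pd_const', pd_log' hdd hd0, pd_log' hbn1 hne, pd_sub' (by fun_prop) hbn, pd_const',
    pd_quad_inv hda hdb hd0 hs, ← bup_bcov hs, pd_det hda, sum_christoffel hs]
  have e : (∑ i, ∑ j, (a x).adjugate i j * pd k (fun z => a z j i) x) / (a x).det =
      ∑ i, ∑ j, (a x)⁻¹ i j * pd k (fun z => a z i j) x := by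
    rw [Finset.sum_div, Finset.sum_comm]
    simp only [Finset.sum_div]
    rw [Finset.sum_comm]
    conv_rhs => rw [Finset.sum_comm]
    refine Finset.sum_congr rfl fun i _ => Finset.sum_congr rfl fun j _ => ?_
    rw [inv_symm hs i j, Matrix.inv_def]
    simp; field_simp
  rw [e]; field_simp; ring
end LogSigma


section YDeriv
variable {n : ℕ} {a : Vec n → Matrix (Fin n) (Fin n) ℝ} {b : Vec n → Vec n} {x y : Vec n}

lemma ralpha_eq (y : Vec n) : ralpha a x y = Real.sqrt (y ⬝ᵥ (a x *ᵥ y)) := by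
  rw [ralpha, quad_eq]

lemma ralpha_pos (hp : (a x).PosDef) (hy : y ≠ 0) : 0 < ralpha a x y := by
  rw [ralpha_eq]; exact Real.sqrt_pos.2 (pos_quad hp hy)

lemma ralpha_sq (hp : (a x).PosDef) : ralpha a x y ^ 2 = y ⬝ᵥ (a x *ᵥ y) := by
  rw [ralpha_eq, Real.sq_sqrt]
  simpa using hp.posSemidef.dotProduct_mulVec_nonneg y

lemma pd_mulVec_y {M : Matrix (Fin n) (Fin n) ℝ} {l j : Fin n} :
    pd j (fun z => (M *ᵥ z) l) y = M l j := by
  simp only [Matrix.mulVec, dotProduct]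
  rw [pd_sum' (by intros; fun_prop)]
  have : ∀ k, pd j (fun z : Vec n => M l k * z k) y = M l k * (if j = k then 1 else 0) := by
    intro k; rw [pd_mul' (by fun_prop) (by fun_prop), pd_const', pd_coord]; ring
  simp [this]

lemma diff_mulVec_y {M : Matrix (Fin n) (Fin n) ℝ} {l : Fin n} :
    DifferentiableAt ℝ (fun z => (M *ᵥ z) l) y := by
  simp only [Matrix.mulVec, dotProduct]; fun_prop

lemma diff_quad_y {M : Matrix (Fin n) (Fin n) ℝ} :
    DifferentiableAt ℝ (fun z : Vec n => z ⬝ᵥ (M *ᵥ z)) y := by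
  simp only [Matrix.mulVec, dotProduct]; fun_prop

lemma pd_quad_y {M : Matrix (Fin n) (Fin n) ℝ} (hs : M.IsSymm) {j : Fin n} :
    pd j (fun z : Vec n => z ⬝ᵥ (M *ᵥ z)) y = 2 * (M *ᵥ y) j := by
  simp only [dotProduct]
  rw [pd_sum' (fun i _ => (by fun_prop : DifferentiableAt ℝ (fun z : Vec n => z i) y).fun_mul
    diff_mulVec_y)]
  have : ∀ i, pd j (fun z : Vec n => z i * (M *ᵥ z) i) y =
      (if j = i then 1 else 0) * (M *ᵥ y) i + M j i * y i := by
    intro i; rw [pd_mul' (by fun_prop) diff_mulVec_y, pd_coord, pd_mulVec_y, hs.apply]; ring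
  simp only [this, Finset.sum_add_distrib]
  simp [Matrix.mulVec, dotProduct]; ring

lemma pd_rbeta_y {j : Fin n} : pd j (rbeta b x) y = b x j := by
  have : rbeta b x = fun z => ∑ i, b x i * z i := rfl
  rw [this, pd_sum' (by intros; fun_prop)]
  have : ∀ k, pd j (fun z : Vec n => b x k * z k) y = b x k * (if j = k then 1 else 0) := by
    intro k; rw [pd_mul' (by fun_prop) (by fun_prop), pd_const', pd_coord]; ring
  simp [this]

lemma diff_rbeta_y : DifferentiableAt ℝ (rbeta b x) y := by
  unfold rbeta; fun_prop

lemma diff_ralpha_y (hp : (a x).PosDef) (hy : y ≠ 0) : DifferentiableAt ℝ (ralpha a x) y := by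
  have : ralpha a x = fun z => Real.sqrt (z ⬝ᵥ (a x *ᵥ z)) := funext ralpha_eq
  rw [this]
  exact diff_quad_y.sqrt (pos_quad hp hy).ne'

lemma pd_ralpha_y (hs : (a x).IsSymm) (hp : (a x).PosDef) (hy : y ≠ 0) {j : Fin n} :
    pd j (ralpha a x) y = (a x *ᵥ y) j / ralpha a x y := by
  have : ralpha a x = fun z => Real.sqrt (z ⬝ᵥ (a x *ᵥ z)) := funext ralpha_eq
  rw [this, pd_sqrt' diff_quad_y (pos_quad hp hy).ne', pd_quad_y hs]
  simp only []
  rw [mul_div_mul_left _ _ two_ne_zero]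

lemma diff_div' {f g : Vec n → ℝ} (hf : DifferentiableAt ℝ f y) (hg : DifferentiableAt ℝ g y)
    (h : g y ≠ 0) : DifferentiableAt ℝ (fun z => f z / g z) y := by
  simp only [div_eq_mul_inv]
  exact hf.fun_mul (hg.fun_inv h)

lemma pd_sq' {i : Fin n} {f : Vec n → ℝ} (hf : DifferentiableAt ℝ f y) :
    pd i (fun z => f z ^ 2) y = 2 * f y * pd i f y := by
  simp only [sq]; rw [pd_mul' hf hf]; ring

variable {F : Vec n → Vec n → ℝ}

lemma F_fun (hFdef : ∀ x y, F x y = ralpha a x y + rbeta b x y) (x : Vec n) :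
    F x = fun z => ralpha a x z + rbeta b x z := funext (hFdef x)

lemma dy_F2 (hFdef : ∀ x y, F x y = ralpha a x y + rbeta b x y)
    (hs : (a x).IsSymm) (hp : (a x).PosDef) (hy : y ≠ 0) (j : Fin n) :
    dy j (F2 F) x y = 2 * F x y * ((a x *ᵥ y) j / ralpha a x y + b x j) := by
  have e : F2 F x = fun z => (ralpha a x z + rbeta b x z) ^ 2 := by
    funext z; rw [F2, hFdef]
  unfold dy
  rw [e, pd_sq' ((diff_ralpha_y hp hy).fun_add diff_rbeta_y),
    pd_add' (diff_ralpha_y hp hy) diff_rbeta_y, pd_ralpha_y hs hp hy, pd_rbeta_y, hFdef]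

lemma gmat_eq (hFdef : ∀ x y, F x y = ralpha a x y + rbeta b x y)
    (hs : (a x).IsSymm) (hp : (a x).PosDef) (hy : y ≠ 0) (i j : Fin n) :
    gmat F x y i j = ((a x *ᵥ y) i / ralpha a x y + b x i) * ((a x *ᵥ y) j / ralpha a x y + b x j)
      + F x y * (a x i j / ralpha a x y - (a x *ᵥ y) i * (a x *ᵥ y) j / ralpha a x y ^ 3) := by
  have hα := ralpha_pos hp hy
  have hdα := diff_ralpha_y hp hy
  have hev : (fun z => dy j (F2 F) x z) =ᶠ[nhds y] fun z =>
      2 * (ralpha a x z + rbeta b x z) * ((a x *ᵥ z) j / ralpha a x z + b x j) := by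
    filter_upwards [isOpen_ne.mem_nhds hy] with z hz
    rw [dy_F2 hFdef hs hp hz, hFdef]
  have e : gmat F x y i j = 1/2 * pd i (fun z => dy j (F2 F) x z) y := rfl
  have d1 : DifferentiableAt ℝ (fun z => ralpha a x z + rbeta b x z) y :=
    hdα.fun_add diff_rbeta_y
  have d2 : DifferentiableAt ℝ (fun z => (a x *ᵥ z) j / ralpha a x z) y :=
    diff_div' diff_mulVec_y hdα hα.ne'
  rw [e, pd_congr hev, pd_mul' (d1.const_mul 2) (d2.add_const _), pd_mul' (by fun_prop) d1,
    pd_const', pd_add' hdα diff_rbeta_y, pd_add' d2 (by fun_prop), pd_const',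
    pd_div' diff_mulVec_y hdα hα.ne', pd_mulVec_y, pd_ralpha_y hs hp hy, pd_rbeta_y, hFdef,
    hs.apply]
  field_simp
  ring
end YDeriv

section XDeriv
variable {n : ℕ} {a : Vec n → Matrix (Fin n) (Fin n) ℝ} {b : Vec n → Vec n} {x y : Vec n}

/-- derivative matrix -/
noncomputable def daM (a : Vec n → Matrix (Fin n) (Fin n) ℝ) (x : Vec n) (m : Fin n) :
    Matrix (Fin n) (Fin n) ℝ := Matrix.of fun i j => pd m (fun z => a z i j) x

/-- derivative covector -/
noncomputable def dbV (b : Vec n → Vec n) (x : Vec n) (m : Fin n) : Vec n := fun i => pd m (fun z => b z i) x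

lemma diff_mulVec_x (hda : ∀ i j, DifferentiableAt ℝ (fun z => a z i j) x) {l : Fin n} :
    DifferentiableAt ℝ (fun z => (a z *ᵥ y) l) x := by
  simp only [Matrix.mulVec, dotProduct]; fun_prop

lemma pd_mulVec_x (hda : ∀ i j, DifferentiableAt ℝ (fun z => a z i j) x) {l m : Fin n} :
    pd m (fun z => (a z *ᵥ y) l) x = (daM a x m *ᵥ y) l := by
  simp only [Matrix.mulVec, dotProduct]
  rw [pd_sum' (by intros; fun_prop)]
  refine Finset.sum_congr rfl fun k _ => ?_
  rw [pd_mul' (by fun_prop) (by fun_prop), pd_const']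
  simp [daM]

lemma diff_quad_x (hda : ∀ i j, DifferentiableAt ℝ (fun z => a z i j) x) :
    DifferentiableAt ℝ (fun z => y ⬝ᵥ (a z *ᵥ y)) x := by
  simp only [Matrix.mulVec, dotProduct]; fun_prop

lemma pd_quad_x (hda : ∀ i j, DifferentiableAt ℝ (fun z => a z i j) x) {m : Fin n} :
    pd m (fun z => y ⬝ᵥ (a z *ᵥ y)) x = y ⬝ᵥ (daM a x m *ᵥ y) := by
  simp only [dotProduct]
  rw [pd_sum' (fun i _ => (diff_mulVec_x hda).const_mul (y i))]
  refine Finset.sum_congr rfl fun k _ => ?_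
  rw [pd_mul' (by fun_prop) (diff_mulVec_x hda), pd_const', pd_mulVec_x hda]
  simp

lemma diff_rbeta_x (hdb : ∀ i, DifferentiableAt ℝ (fun z => b z i) x) :
    DifferentiableAt ℝ (fun z => rbeta b z y) x := by
  unfold rbeta; fun_prop

lemma pd_rbeta_x (hdb : ∀ i, DifferentiableAt ℝ (fun z => b z i) x) {m : Fin n} :
    pd m (fun z => rbeta b z y) x = dbV b x m ⬝ᵥ y := by
  unfold rbeta
  rw [pd_sum' (by intros; fun_prop)]
  refine Finset.sum_congr rfl fun k _ => ?_
  rw [pd_mul' (by fun_prop) (by fun_prop), pd_const']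
  simp [dbV]

lemma diff_ralpha_x (hda : ∀ i j, DifferentiableAt ℝ (fun z => a z i j) x)
    (hp : (a x).PosDef) (hy : y ≠ 0) : DifferentiableAt ℝ (fun z => ralpha a z y) x := by
  simp only [ralpha_eq]
  exact (diff_quad_x hda).sqrt (pos_quad hp hy).ne'

lemma pd_ralpha_x (hda : ∀ i j, DifferentiableAt ℝ (fun z => a z i j) x)
    (hp : (a x).PosDef) (hy : y ≠ 0) {m : Fin n} :
    pd m (fun z => ralpha a z y) x = (y ⬝ᵥ (daM a x m *ᵥ y)) / (2 * ralpha a x y) := by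
  simp only [ralpha_eq]
  rw [pd_sqrt' (diff_quad_x hda) (pos_quad hp hy).ne', pd_quad_x hda]

variable {F : Vec n → Vec n → ℝ}

lemma dx_F2 (hFdef : ∀ x y, F x y = ralpha a x y + rbeta b x y)
    (hda : ∀ i j, DifferentiableAt ℝ (fun z => a z i j) x)
    (hdb : ∀ i, DifferentiableAt ℝ (fun z => b z i) x)
    (hp : (a x).PosDef) (hy : y ≠ 0) (l : Fin n) :
    dx l (F2 F) x y =
      2 * F x y * ((y ⬝ᵥ (daM a x l *ᵥ y)) / (2 * ralpha a x y) + dbV b x l ⬝ᵥ y) := by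
  have e : (fun x' => F2 F x' y) = fun z => (ralpha a z y + rbeta b z y) ^ 2 := by
    funext z; rw [F2, hFdef]
  unfold dx
  rw [e, pd_sq' ((diff_ralpha_x hda hp hy).fun_add (diff_rbeta_x hdb)),
    pd_add' (diff_ralpha_x hda hp hy) (diff_rbeta_x hdb), pd_ralpha_x hda hp hy,
    pd_rbeta_x hdb, hFdef]

lemma dx_dy_F2 (hFdef : ∀ x y, F x y = ralpha a x y + rbeta b x y)
    {U : Set (Vec n)} (hU : IsOpen U) (hx : x ∈ U)
    (h : ∀ x ∈ U, (a x).IsSymm ∧ (a x).PosDef ∧ bnormsq a b x < 1)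
    (hda : ∀ i j, DifferentiableAt ℝ (fun z => a z i j) x)
    (hdb : ∀ i, DifferentiableAt ℝ (fun z => b z i) x)
    (hy : y ≠ 0) (l m : Fin n) :
    dx m (fun x' y' => dy l (F2 F) x' y') x y =
      2 * ((y ⬝ᵥ (daM a x m *ᵥ y)) / (2 * ralpha a x y) + dbV b x m ⬝ᵥ y)
        * ((a x *ᵥ y) l / ralpha a x y + b x l)
      + 2 * F x y * ((daM a x m *ᵥ y) l / ralpha a x y
        - (a x *ᵥ y) l * (y ⬝ᵥ (daM a x m *ᵥ y)) / (2 * ralpha a x y ^ 3) + dbV b x m l) := by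
  obtain ⟨hs, hp, -⟩ := h x hx
  have hα := ralpha_pos hp hy
  have hdα := diff_ralpha_x hda hp hy
  have hev : (fun z => dy l (F2 F) z y) =ᶠ[nhds x] fun z =>
      2 * (ralpha a z y + rbeta b z y) * ((a z *ᵥ y) l / ralpha a z y + b z l) := by
    filter_upwards [hU.mem_nhds hx] with z hz
    rw [dy_F2 hFdef (h z hz).1 (h z hz).2.1 hy, hFdef]
  have d1 : DifferentiableAt ℝ (fun z => ralpha a z y + rbeta b z y) x :=
    hdα.fun_add (diff_rbeta_x hdb)
  have d3 := diff_mulVec_x (y := y) (l := l) hda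
  have d2 : DifferentiableAt ℝ (fun z => (a z *ᵥ y) l / ralpha a z y) x :=
    diff_div' d3 hdα hα.ne'
  have e : dx m (fun x' y' => dy l (F2 F) x' y') x y = pd m (fun z => dy l (F2 F) z y) x := rfl
  rw [e, pd_congr hev, pd_mul' (d1.const_mul 2) (d2.fun_add (hdb l)), pd_mul' (by fun_prop) d1,
    pd_const', pd_add' hdα (diff_rbeta_x hdb), pd_add' d2 (hdb l),
    pd_div' d3 hdα hα.ne', pd_mulVec_x hda, pd_ralpha_x hda hp hy, pd_rbeta_x hdb, hFdef]
  have : pd m (fun z => b z l) x = dbV b x m l := rfl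
  rw [this]
  field_simp
  ring
end XDeriv


section Spray
variable {n : ℕ} {a : Vec n → Matrix (Fin n) (Fin n) ℝ} {b : Vec n → Vec n} {x y : Vec n}

noncomputable def Kv (a : Vec n → Matrix (Fin n) (Fin n) ℝ) (x y : Vec n) : Vec n := fun l =>
  ∑ m, (daM a x m *ᵥ y) l * y m - (1/2) * (y ⬝ᵥ (daM a x l *ᵥ y))

noncomputable def S0v (b : Vec n → Vec n) (x y : Vec n) : Vec n := fun l =>
  (1/2) * (∑ m, dbV b x m l * y m - dbV b x l ⬝ᵥ y)

noncomputable def s0f (a : Vec n → Matrix (Fin n) (Fin n) ℝ) (b : Vec n → Vec n)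
    (x y : Vec n) : ℝ := ∑ j, slow a b j x * y j

noncomputable def r00f (a : Vec n → Matrix (Fin n) (Fin n) ℝ) (b : Vec n → Vec n)
    (x y : Vec n) : ℝ := ∑ i, ∑ j, rten a b i j x * y i * y j

noncomputable def Pf (a : Vec n → Matrix (Fin n) (Fin n) ℝ) (b : Vec n → Vec n)
    (x y : Vec n) : ℝ := e00 a b x y / (2 * (ralpha a x y + rbeta b x y)) - s0f a b x y

lemma daM_symm {U : Set (Vec n)} (hU : IsOpen U) (hx : x ∈ U)
    (h : ∀ x ∈ U, (a x).IsSymm) (m : Fin n) : (daM a x m).IsSymm := by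
  ext i j
  have : (fun z => a z j i) =ᶠ[nhds x] fun z => a z i j := by
    filter_upwards [hU.mem_nhds hx] with z hz
    exact (h z hz).apply i j
  simp only [Matrix.transpose_apply, daM, Matrix.of_apply]
  exact pd_congr this

lemma daM_apply (m i j : Fin n) : pd m (fun z => a z i j) x = daM a x m i j := rfl
lemma dbV_apply (m i : Fin n) : pd m (fun z => b z i) x = dbV b x m i := rfl

lemma christoffel_symm (hd : ∀ m, (daM a x m).IsSymm) (k i j : Fin n) :
    christoffel a k i j x = christoffel a k j i x := by
  unfold christoffel
  simp only [daM_apply]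
  congr 1
  refine Finset.sum_congr rfl fun l _ => ?_
  rw [(hd i).apply l j, (hd j).apply l i, (hd l).apply i j]; ring

lemma Kv_eq (hd : ∀ m, (daM a x m).IsSymm) (l : Fin n) :
    ∑ j, ∑ k, (daM a x j l k + daM a x k j l - daM a x l j k) * y j * y k = 2 * Kv a x y l := by
  have e1 : ∑ j, ∑ k, daM a x j l k * y j * y k = ∑ m, (daM a x m *ᵥ y) l * y m := by
    refine Finset.sum_congr rfl fun j _ => ?_
    simp only [Matrix.mulVec, dotProduct, Finset.sum_mul]
    exact Finset.sum_congr rfl fun k _ => by ring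
  have e2 : ∑ j, ∑ k, daM a x k j l * y j * y k = ∑ m, (daM a x m *ᵥ y) l * y m := by
    rw [Finset.sum_comm]
    refine Finset.sum_congr rfl fun j _ => ?_
    simp only [Matrix.mulVec, dotProduct, Finset.sum_mul]
    refine Finset.sum_congr rfl fun k _ => ?_
    rw [(hd j).apply]
  have e3 := quad_eq (daM a x l) y
  simp only [sub_mul, add_mul, Finset.sum_add_distrib, Finset.sum_sub_distrib, e1, e2, e3, Kv]
  ring

lemma gam_yy (hd : ∀ m, (daM a x m).IsSymm) (i : Fin n) :
    ∑ j, ∑ k, christoffel a i j k x * y j * y k = ((a x)⁻¹ *ᵥ Kv a x y) i := by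
  have : ((a x)⁻¹ *ᵥ Kv a x y) i = ∑ l, (1/2) * ((a x)⁻¹ i l *
      ∑ j, ∑ k, (daM a x j l k + daM a x k j l - daM a x l j k) * y j * y k) := by
    simp only [Kv_eq hd, Matrix.mulVec, dotProduct]
    exact Finset.sum_congr rfl fun l _ => by ring
  rw [this]
  simp only [Finset.mul_sum]
  conv_rhs => rw [Finset.sum_comm]
  refine Finset.sum_congr rfl fun j _ => ?_
  conv_rhs => rw [Finset.sum_comm]
  refine Finset.sum_congr rfl fun k _ => ?_
  unfold christoffel
  simp only [Finset.mul_sum, Finset.sum_mul, daM_apply]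
  exact Finset.sum_congr rfl fun l _ => by ring

lemma sten_eq (hd : ∀ m, (daM a x m).IsSymm) (l k : Fin n) :
    sten a b l k x = (1/2) * (dbV b x k l - dbV b x l k) := by
  unfold sten bcov
  simp only [dbV_apply, christoffel_symm hd _ l k]; ring

lemma S0_eq (hd : ∀ m, (daM a x m).IsSymm) (l : Fin n) :
    ∑ k, sten a b l k x * y k = S0v b x y l := by
  simp only [sten_eq hd, S0v, dotProduct, ← Finset.sum_sub_distrib, Finset.mul_sum]
  exact Finset.sum_congr rfl fun k _ => by ring

lemma y_S0 : y ⬝ᵥ S0v b x y = 0 := by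
  have : ∑ l, ∑ m, y l * (dbV b x m l * y m) = ∑ l, ∑ m, y l * (dbV b x l m * y m) := by
    rw [Finset.sum_comm]
    exact Finset.sum_congr rfl fun i _ => Finset.sum_congr rfl fun j _ => by ring
  have e : ∀ l, y l * S0v b x y l = (1/2) * (∑ m, y l * (dbV b x m l * y m)) -
      (1/2) * ∑ m, y l * (dbV b x l m * y m) := by
    intro l; simp only [S0v, dotProduct, ← Finset.mul_sum]; ring
  simp only [dotProduct]
  rw [Finset.sum_congr rfl fun l _ => e l, Finset.sum_sub_distrib, ← Finset.mul_sum,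
    ← Finset.mul_sum, this, sub_self]

lemma y_Kv : y ⬝ᵥ Kv a x y = (1/2) * ∑ m, (y ⬝ᵥ (daM a x m *ᵥ y)) * y m := by
  have e : ∀ l, y l * Kv a x y l = (∑ m, y l * (daM a x m *ᵥ y) l * y m) -
      (1/2) * ((y ⬝ᵥ (daM a x l *ᵥ y)) * y l) := by
    intro l; simp only [Kv, mul_sub, Finset.mul_sum]
    congr 1
    · exact Finset.sum_congr rfl fun k _ => by ring
    · ring
  have e2 : ∑ l, ∑ m, y l * (daM a x m *ᵥ y) l * y m = ∑ m, (y ⬝ᵥ (daM a x m *ᵥ y)) * y m := by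
    rw [Finset.sum_comm]
    refine Finset.sum_congr rfl fun m _ => ?_
    rw [dotProduct, Finset.sum_mul]
  rw [dotProduct, Finset.sum_congr rfl fun l _ => e l, Finset.sum_sub_distrib, ← Finset.mul_sum,
    e2]; ring

lemma s0f_eq (hd : ∀ m, (daM a x m).IsSymm) :
    s0f a b x y = ((a x)⁻¹ *ᵥ b x) ⬝ᵥ S0v b x y := by
  have e : ∀ i, ((a x)⁻¹ *ᵥ b x) i * S0v b x y i = ∑ k, bup a b i x * sten a b i k x * y k := by
    intro i; rw [← S0_eq (a := a) hd, Finset.mul_sum]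
    refine Finset.sum_congr rfl fun k _ => ?_
    rw [mul_assoc]; rfl
  rw [dotProduct, Finset.sum_congr rfl fun i _ => e i, Finset.sum_comm]
  unfold s0f slow
  simp only [Finset.sum_mul]

lemma b_inv (hs : (a x).IsSymm) (v : Vec n) :
    b x ⬝ᵥ ((a x)⁻¹ *ᵥ v) = ((a x)⁻¹ *ᵥ b x) ⬝ᵥ v := by
  rw [Matrix.dotProduct_mulVec, ← Matrix.mulVec_transpose, Matrix.transpose_nonsing_inv, hs.eq]

lemma r00f_eq (hs : (a x).IsSymm) (hd : ∀ m, (daM a x m).IsSymm) :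
    r00f a b x y = (∑ m, (dbV b x m ⬝ᵥ y) * y m) - ((a x)⁻¹ *ᵥ b x) ⬝ᵥ Kv a x y := by
  have e1 : r00f a b x y = ∑ i, ∑ j, bcov a b i j x * y i * y j := by
    have : ∑ i, ∑ j, bcov a b j i x * y i * y j = ∑ i, ∑ j, bcov a b i j x * y i * y j := by
      rw [Finset.sum_comm]
      exact Finset.sum_congr rfl fun i _ => Finset.sum_congr rfl fun j _ => by ring
    have e : r00f a b x y = (1/2) * ((∑ i, ∑ j, bcov a b i j x * y i * y j) +
        ∑ i, ∑ j, bcov a b j i x * y i * y j) := by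
      unfold r00f rten
      simp only [← Finset.sum_add_distrib, Finset.mul_sum]
      exact Finset.sum_congr rfl fun i _ => Finset.sum_congr rfl fun j _ => by ring
    rw [e, this]; ring
  have e2 : ((a x)⁻¹ *ᵥ b x) ⬝ᵥ Kv a x y =
      ∑ i, ∑ j, (∑ k, b x k * christoffel a k i j x) * y i * y j := by
    rw [← b_inv hs, dotProduct]
    simp only [← gam_yy hd, Finset.mul_sum, Finset.sum_mul]
    rw [Finset.sum_comm]
    refine Finset.sum_congr rfl fun j _ => ?_
    rw [Finset.sum_comm]
    exact Finset.sum_congr rfl fun i _ => Finset.sum_congr rfl fun j _ => by ring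
  have e3 : ∑ m, (dbV b x m ⬝ᵥ y) * y m = ∑ i, ∑ j, dbV b x j i * y i * y j := by
    rw [Finset.sum_comm]
    simp only [dotProduct, Finset.sum_mul]
  rw [e1, e2, e3, ← Finset.sum_sub_distrib]
  refine Finset.sum_congr rfl fun i _ => ?_
  rw [← Finset.sum_sub_distrib]
  refine Finset.sum_congr rfl fun j _ => ?_
  rw [bcov, dbV_apply]; ring

lemma e00_eq : e00 a b x y = r00f a b x y + 2 * rbeta b x y * s0f a b x y := by
  have e1 : rbeta b x y * s0f a b x y = ∑ i, ∑ j, b x i * slow a b j x * y i * y j := by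
    unfold rbeta s0f
    rw [Finset.sum_mul_sum]
    exact Finset.sum_congr rfl fun i _ => Finset.sum_congr rfl fun j _ => by ring
  have e2 : rbeta b x y * s0f a b x y = ∑ i, ∑ j, b x j * slow a b i x * y i * y j := by
    rw [e1, Finset.sum_comm]
    exact Finset.sum_congr rfl fun i _ => Finset.sum_congr rfl fun j _ => by ring
  have : 2 * rbeta b x y * s0f a b x y = rbeta b x y * s0f a b x y + rbeta b x y * s0f a b x y := by
    ring
  rw [this]; nth_rewrite 1 [e1]; rw [e2]
  unfold e00 r00f
  simp only [← Finset.sum_add_distrib]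
  exact Finset.sum_congr rfl fun i _ => Finset.sum_congr rfl fun j _ => by ring

variable {F : Vec n → Vec n → ℝ}

lemma gmat_mulVec (hFdef : ∀ x y, F x y = ralpha a x y + rbeta b x y)
    (hs : (a x).IsSymm) (hp : (a x).PosDef) (hy : y ≠ 0) (v : Vec n) (i : Fin n) :
    (gmat F x y *ᵥ v) i = ((a x *ᵥ y) i / ralpha a x y + b x i) *
        (((a x *ᵥ y) ⬝ᵥ v) / ralpha a x y + b x ⬝ᵥ v)
      + F x y * ((a x *ᵥ v) i / ralpha a x y
        - (a x *ᵥ y) i * ((a x *ᵥ y) ⬝ᵥ v) / ralpha a x y ^ 3) := by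
  have e1 : (a x *ᵥ v) i = ∑ j, a x i j * v j := rfl
  have e2 : (gmat F x y *ᵥ v) i = ∑ j, gmat F x y i j * v j := rfl
  rw [e1, e2]
  simp only [gmat_eq hFdef hs hp hy]
  generalize a x *ᵥ y = w
  simp only [dotProduct, Finset.sum_div, Finset.mul_sum, ← Finset.sum_add_distrib,
    ← Finset.sum_sub_distrib]
  refine Finset.sum_congr rfl fun j _ => ?_
  ring

/-- closed form of the spray -/
noncomputable def Gc (a : Vec n → Matrix (Fin n) (Fin n) ℝ) (b : Vec n → Vec n)
    (x y : Vec n) : Vec n :=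
  (1/2 : ℝ) • ((a x)⁻¹ *ᵥ Kv a x y) + Pf a b x y • y + ralpha a x y • ((a x)⁻¹ *ᵥ S0v b x y)

lemma Geo_eq (hFdef : ∀ x y, F x y = ralpha a x y + rbeta b x y)
    {U : Set (Vec n)} (hU : IsOpen U) (hx : x ∈ U)
    (h : ∀ x ∈ U, (a x).IsSymm ∧ (a x).PosDef ∧ bnormsq a b x < 1)
    (hda : ∀ i j, DifferentiableAt ℝ (fun z => a z i j) x)
    (hdb : ∀ i, DifferentiableAt ℝ (fun z => b z i) x)
    (hy : y ≠ 0) (hF : 0 < F x y) (hg : (gmat F x y).det ≠ 0) (i : Fin n) :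
    Geo F i x y = Gc a b x y i := by
  obtain ⟨hs, hp, -⟩ := h x hx
  have hd := fun m => daM_symm hU hx (fun z hz => (h z hz).1) m
  have hα := ralpha_pos hp hy
  set E : Vec n := fun l =>
    (∑ m, dx m (fun x' y' => dy l (F2 F) x' y') x y * y m) - dx l (F2 F) x y with hE
  have key : gmat F x y *ᵥ Gc a b x y = (1/4 : ℝ) • E := by
    ext l
    have hay : ∀ v, (a x *ᵥ y) ⬝ᵥ ((a x)⁻¹ *ᵥ v) = y ⬝ᵥ v := by
      intro v
      rw [Matrix.dotProduct_mulVec, ← Matrix.mulVec_transpose, Matrix.transpose_nonsing_inv, hs.eq,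
        Matrix.mulVec_mulVec, Matrix.nonsing_inv_mul _ (isUnit_iff_ne_zero.2 hp.det_pos.ne'),
        Matrix.one_mulVec]
    have hay2 : (a x *ᵥ y) ⬝ᵥ y = ralpha a x y ^ 2 := by
      rw [dotProduct_comm, ralpha_sq hp]
    have hby : b x ⬝ᵥ y = rbeta b x y := rfl
    have hEl : E l = 2 * ((∑ m, (y ⬝ᵥ (daM a x m *ᵥ y)) * y m) / (2 * ralpha a x y)
          + ∑ m, (dbV b x m ⬝ᵥ y) * y m) * ((a x *ᵥ y) l / ralpha a x y + b x l)
        + 2 * F x y * ((∑ m, (daM a x m *ᵥ y) l * y m) / ralpha a x y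
          - (a x *ᵥ y) l * (∑ m, (y ⬝ᵥ (daM a x m *ᵥ y)) * y m) / (2 * ralpha a x y ^ 3)
          + ∑ m, dbV b x m l * y m)
        - 2 * F x y * ((y ⬝ᵥ (daM a x l *ᵥ y)) / (2 * ralpha a x y) + dbV b x l ⬝ᵥ y) := by
      simp only [hE, dx_dy_F2 hFdef hU hx h hda hdb hy, dx_F2 hFdef hda hdb hp hy]
      congr 1
      simp only [Finset.sum_div, Finset.mul_sum, ← Finset.sum_add_distrib,
        ← Finset.sum_sub_distrib, Finset.sum_mul]
      refine Finset.sum_congr rfl fun m _ => by ring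
    rw [Pi.smul_apply, smul_eq_mul, hEl]
    simp only [Gc, Matrix.mulVec_add, Matrix.mulVec_smul, Pi.add_apply, Pi.smul_apply, smul_eq_mul]
    simp only [gmat_mulVec hFdef hs hp hy, hay, hay2, hby, y_S0, y_Kv, b_inv hs, exists_u hp]
    rw [← s0f_eq hd]
    have hr := r00f_eq (b := b) (y := y) hs hd
    have hr2 : ((a x)⁻¹ *ᵥ b x) ⬝ᵥ Kv a x y =
      (∑ m, (dbV b x m ⬝ᵥ y) * y m) - r00f a b x y := by linarith
    rw [hr2]
    have hP : Pf a b x y * F x y = r00f a b x y / 2 - ralpha a x y * s0f a b x y := by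
      rw [Pf, e00_eq, hFdef]
      rw [hFdef] at hF
      field_simp; ring
    have hb : rbeta b x y = F x y - ralpha a x y := by rw [hFdef]; ring
    rw [hb]
    simp only [Kv, S0v]
    clear_value E
    generalize r00f a b x y = r at *
    generalize s0f a b x y = s at *
    generalize ralpha a x y = α at *
    generalize F x y = f at *
    generalize Pf a b x y = P at *
    have hr3 : r = 2 * (P * f + α * s) := by linarith
    rw [hr3]
    field_simp
    ring
  have : Geo F i x y = (ginv F x y *ᵥ ((1/4 : ℝ) • E)) i := by
    rw [Matrix.mulVec_smul]; rfl
  rw [this, ← key, ginv, Matrix.mulVec_mulVec,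
    Matrix.nonsing_inv_mul _ (isUnit_iff_ne_zero.2 hg), Matrix.one_mulVec]
end Spray


section Diverg
variable {n : ℕ} {a : Vec n → Matrix (Fin n) (Fin n) ℝ} {b : Vec n → Vec n} {x y : Vec n}

lemma rbeta_smul (t : ℝ) : rbeta b x (t • y) = t * rbeta b x y := by
  unfold rbeta; rw [Finset.mul_sum]
  exact Finset.sum_congr rfl fun i _ => by simp; ring

lemma s0f_smul (t : ℝ) : s0f a b x (t • y) = t * s0f a b x y := by
  unfold s0f; rw [Finset.mul_sum]
  exact Finset.sum_congr rfl fun i _ => by simp; ring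

lemma e00_smul (t : ℝ) : e00 a b x (t • y) = t ^ 2 * e00 a b x y := by
  unfold e00; simp only [Finset.mul_sum]
  exact Finset.sum_congr rfl fun i _ => Finset.sum_congr rfl fun j _ => by simp; ring

lemma ralpha_smul (t : ℝ) : ralpha a x (t • y) = |t| * ralpha a x y := by
  have : (t • y) ⬝ᵥ (a x *ᵥ (t • y)) = t ^ 2 * (y ⬝ᵥ (a x *ᵥ y)) := by
    simp only [Matrix.mulVec_smul, smul_dotProduct, dotProduct_smul, smul_eq_mul]; ring
  rw [ralpha_eq, ralpha_eq, this, Real.sqrt_mul (sq_nonneg t), Real.sqrt_sq_eq_abs]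

lemma Pf_smul (t : ℝ) (ht : 0 < t) : Pf a b x (t • y) = t * Pf a b x y := by
  unfold Pf
  rw [e00_smul, ralpha_smul, rbeta_smul, s0f_smul, abs_of_pos ht, ← mul_add, mul_left_comm 2 t]
  rw [mul_sub, sq, mul_assoc, mul_div_mul_left _ _ ht.ne', mul_div_assoc]

lemma diff_Pf (hp : (a x).PosDef) (hy : y ≠ 0) (hF : ralpha a x y + rbeta b x y ≠ 0) :
    DifferentiableAt ℝ (fun z => Pf a b x z) y := by
  have h1 : DifferentiableAt ℝ (fun z => e00 a b x z) y := by
    unfold e00; fun_prop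
  have h2 : DifferentiableAt ℝ (fun z => s0f a b x z) y := by
    unfold s0f; fun_prop
  unfold Pf
  exact (diff_div' h1 (((diff_ralpha_y hp hy).fun_add diff_rbeta_y).const_mul 2)
    (mul_ne_zero two_ne_zero hF)).fun_sub h2

lemma pd_quad_gen (M : Fin n → Fin n → ℝ) (m : Fin n) :
    pd m (fun z : Vec n => ∑ j, ∑ k, M j k * z j * z k) y
      = ∑ k, (M m k + M k m) * y k := by
  rw [pd_sum' (by intros; fun_prop)]
  have : ∀ j, pd m (fun z : Vec n => ∑ k, M j k * z j * z k) y =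
      ∑ k, (M j k * (if m = j then 1 else 0) * y k + M j k * y j * (if m = k then 1 else 0)) := by
    intro j
    rw [pd_sum' (by intros; fun_prop)]
    refine Finset.sum_congr rfl fun k _ => ?_
    rw [pd_mul' (by fun_prop) (by fun_prop), pd_mul' (by fun_prop) (by fun_prop), pd_const',
      pd_coord, pd_coord]; ring
  simp only [this, Finset.sum_add_distrib, add_mul]
  congr 1
  · rw [Finset.sum_comm]; simp
  · simp

lemma div_Gc (hs : (a x).IsSymm) (hp : (a x).PosDef) (hd : ∀ m, (daM a x m).IsSymm)
    (hy : y ≠ 0) (hF : ralpha a x y + rbeta b x y ≠ 0) :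
    ∑ m, pd m (fun z => Gc a b x z m) y =
      ∑ k, y k * ∑ m, christoffel a m m k x + ((n:ℝ) + 1) * Pf a b x y := by
  have hα := ralpha_pos hp hy
  have hP := diff_Pf hp hy hF
  have hdα := diff_ralpha_y hp hy
  -- the matrix s^i_k
  set T : Matrix (Fin n) (Fin n) ℝ := (a x)⁻¹ * Matrix.of (fun l k => sten a b l k x) with hT
  have hS0 : ∀ z, (a x)⁻¹ *ᵥ S0v b x z = T *ᵥ z := by
    intro z
    have : S0v b x z = Matrix.of (fun l k => sten a b l k x) *ᵥ z := by
      funext l; rw [← S0_eq (a := a) hd]; rfl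
    rw [this, Matrix.mulVec_mulVec]
  have hG : ∀ m, (fun z => Gc a b x z m) = fun z => (1/2) * (∑ j, ∑ k,
      christoffel a m j k x * z j * z k) + Pf a b x z * z m + ralpha a x z * (T *ᵥ z) m := by
    intro m; funext z
    simp only [Gc, Pi.add_apply, Pi.smul_apply, smul_eq_mul, gam_yy hd, hS0]
  have hpd : ∀ m, pd m (fun z => Gc a b x z m) y = ∑ k, christoffel a m m k x * y k
      + (y m * pd m (fun z => Pf a b x z) y + Pf a b x y)
      + ((a x *ᵥ y) m * (T *ᵥ y) m / ralpha a x y + ralpha a x y * T m m) := by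
    intro m
    have d1 : DifferentiableAt ℝ (fun z : Vec n => ∑ j, ∑ k,
      christoffel a m j k x * z j * z k) y := by fun_prop
    have dm : DifferentiableAt ℝ (fun z : Vec n => z m) y := by fun_prop
    rw [hG, pd_add' ((d1.const_mul _).fun_add (hP.fun_mul dm)) (hdα.fun_mul diff_mulVec_y),
      pd_add' (d1.const_mul _) (hP.fun_mul dm), pd_mul' (by fun_prop) d1, pd_mul' hP dm,
      pd_mul' hdα diff_mulVec_y, pd_const', pd_coord, pd_mulVec_y, pd_ralpha_y hs hp hy,
      pd_quad_gen (fun j k => christoffel a m j k x)]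
    have : ∑ k, (christoffel a m m k x + christoffel a m k m x) * y k =
        2 * ∑ k, christoffel a m m k x * y k := by
      rw [Finset.mul_sum]
      refine Finset.sum_congr rfl fun k _ => ?_
      rw [christoffel_symm hd m k m]; ring
    rw [this, if_pos rfl]; ring
  have hanti : ∀ i j, sten a b i j x = - sten a b j i x := by
    intro i j; unfold sten; ring
  have t1 : ∑ m, (a x *ᵥ y) m * (T *ᵥ y) m = 0 := by
    have : ∑ m, (a x *ᵥ y) m * (T *ᵥ y) m = (a x *ᵥ y) ⬝ᵥ ((a x)⁻¹ *ᵥ S0v b x y) := by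
      rw [hS0]; rfl
    rw [this, Matrix.dotProduct_mulVec, ← Matrix.mulVec_transpose, Matrix.transpose_nonsing_inv,
      hs.eq, Matrix.mulVec_mulVec, Matrix.nonsing_inv_mul _ (isUnit_iff_ne_zero.2 hp.det_pos.ne'),
      Matrix.one_mulVec, y_S0]
  have t2 : ∑ m, T m m = 0 := by
    have e1 : ∑ m, T m m = ∑ m, ∑ l, (a x)⁻¹ m l * sten a b l m x := by
      simp only [hT, Matrix.mul_apply, Matrix.of_apply]
    have e2 : ∑ m, ∑ l, (a x)⁻¹ m l * sten a b l m x =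
        - ∑ m, ∑ l, (a x)⁻¹ m l * sten a b l m x := by
      conv_lhs => rw [Finset.sum_comm]
      simp only [← Finset.sum_neg_distrib]
      refine Finset.sum_congr rfl fun l _ => Finset.sum_congr rfl fun m _ => ?_
      rw [hanti l m, inv_symm hs]; ring
    rw [e1]; linarith
  have t3 : ∑ m, y m * pd m (fun z => Pf a b x z) y = Pf a b x y :=
    euler_one hP (fun t ht => Pf_smul t ht)
  simp only [hpd, Finset.sum_add_distrib, ← Finset.mul_sum, ← Finset.sum_div, t1, t2, t3]
  rw [Finset.sum_comm]
  have : ∀ k, ∑ m, christoffel a m m k x * y k = y k * ∑ m, christoffel a m m k x := by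
    intro k; rw [← Finset.sum_mul, mul_comm]
  simp only [this]
  simp; ring

/-- `R(y) = b^i b_{i;k} y^k` -/
noncomputable def Rf (a : Vec n → Matrix (Fin n) (Fin n) ℝ) (b : Vec n → Vec n)
    (x y : Vec n) : ℝ := ∑ k, y k * ∑ i, bup a b i x * bcov a b i k x

variable {F : Vec n → Vec n → ℝ}

lemma SCurv_eq (hFdef : ∀ x y, F x y = ralpha a x y + rbeta b x y)
    {U : Set (Vec n)} (hU : IsOpen U) (hx : x ∈ U)
    (h : ∀ x ∈ U, (a x).IsSymm ∧ (a x).PosDef ∧ bnormsq a b x < 1)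
    (hda : ∀ i j, DifferentiableAt ℝ (fun z => a z i j) x)
    (hdb : ∀ i, DifferentiableAt ℝ (fun z => b z i) x)
    (hF : ∀ y : Vec n, y ≠ 0 → 0 < F x y ∧ (gmat F x y).det ≠ 0) (hy : y ≠ 0) :
    SCurv F x y = ((n:ℝ)+1) * (e00 a b x y / (2 * F x y)
      - (s0f a b x y - Rf a b x y / (1 - bnormsq a b x))) := by
  obtain ⟨hs, hp, -⟩ := h x hx
  have hd := fun m => daM_symm hU hx (fun z hz => (h z hz).1) m
  have hF' : ralpha a x y + rbeta b x y ≠ 0 := by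
    rw [← hFdef]; exact (hF y hy).1.ne'
  have e1 : ∑ m, dy m (Geo F m) x y = ∑ m, pd m (fun z => Gc a b x z m) y := by
    refine Finset.sum_congr rfl fun m _ => ?_
    unfold dy
    refine pd_congr ?_
    filter_upwards [isOpen_ne.mem_nhds hy] with z hz
    exact Geo_eq hFdef hU hx h hda hdb hz (hF z hz).1 (hF z hz).2 m
  rw [SCurv, e1, div_Gc hs hp hd hy hF']
  simp only [pd_log_sigma hU hx hda hdb hFdef h, mul_sub, Finset.sum_sub_distrib]
  have e2 : ∑ k, y k * (((n:ℝ)+1) * ((∑ i, bup a b i x * bcov a b i k x) / (1 - bnormsq a b x)))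
      = ((n:ℝ)+1) * (Rf a b x y / (1 - bnormsq a b x)) := by
    rw [Rf, Finset.sum_div, Finset.mul_sum]
    exact Finset.sum_congr rfl fun k _ => by ring
  rw [e2, Pf, hFdef]; ring

lemma contract (hs : (a x).IsSymm) (hp : (a x).PosDef) (hb : bnormsq a b x < 1)
    {c : ℝ} (H : ∀ y, e00 a b x y = 2 * c * (ralpha a x y ^ 2 - rbeta b x y ^ 2)) (y : Vec n) :
    s0f a b x y - Rf a b x y / (1 - bnormsq a b x) = - 2 * c * rbeta b x y := by
  set u := (a x)⁻¹ *ᵥ b x with hu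
  have hau : a x *ᵥ u = b x := exists_u hp (b x)
  have hbu : b x ⬝ᵥ u = bnormsq a b x := (bnormsq_eq a b x).symm
  set E : Matrix (Fin n) (Fin n) ℝ := Matrix.of fun i j =>
    rten a b i j x + b x i * slow a b j x + b x j * slow a b i x with hE
  have hEs : E.IsSymm := by
    ext i j; simp only [hE, Matrix.transpose_apply, Matrix.of_apply, rten]; ring
  have he : ∀ z, e00 a b x z = z ⬝ᵥ (E *ᵥ z) := by
    intro z; rw [← quad_eq]; rfl
  have hr : ∀ z, rbeta b x z = b x ⬝ᵥ z := fun z => rfl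
  have H1 := H (y + (1:ℝ) • u)
  have H2 := H y
  have H3 := H u
  rw [he, ralpha_sq hp, hr, quad_add hEs, quad_add hs, dotProduct_add, dotProduct_smul, hau] at H1
  rw [he, ralpha_sq hp, hr] at H2
  rw [he, ralpha_sq hp, hr, hau] at H3
  rw [dotProduct_comm y (b x), dotProduct_comm u (b x), hbu] at H1
  rw [dotProduct_comm u (b x), hbu] at H3
  simp only [smul_eq_mul] at H1
  -- compute y E u
  have hub : ∀ i, bup a b i x = u i := fun i => rfl
  have hsu : ∑ j, slow a b j x * u j = 0 := by
    have e1 : ∑ j, slow a b j x * u j = ∑ j, ∑ i, u i * u j * sten a b i j x := by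
      refine Finset.sum_congr rfl fun j _ => ?_
      rw [slow, Finset.sum_mul]
      exact Finset.sum_congr rfl fun i _ => by rw [hub]; ring
    have e2 : ∑ j, ∑ i, u i * u j * sten a b i j x = - ∑ j, ∑ i, u i * u j * sten a b i j x := by
      conv_lhs => rw [Finset.sum_comm]
      simp only [← Finset.sum_neg_distrib]
      refine Finset.sum_congr rfl fun l _ => Finset.sum_congr rfl fun m _ => ?_
      unfold sten; ring
    rw [e1]; linarith
  have hEu : y ⬝ᵥ (E *ᵥ u) = ∑ i, ∑ j, rten a b i j x * y i * u j
      + bnormsq a b x * s0f a b x y := by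
    have : ∀ i, y i * (E *ᵥ u) i = ∑ j, rten a b i j x * y i * u j
        + b x i * y i * (∑ j, slow a b j x * u j) + (b x ⬝ᵥ u) * (slow a b i x * y i) := by
      intro i
      simp only [Matrix.mulVec, dotProduct, hE, Matrix.of_apply, Finset.mul_sum, Finset.sum_mul,
        ← Finset.sum_add_distrib]
      exact Finset.sum_congr rfl fun j _ => by ring
    rw [dotProduct]
    simp only [this, hsu, hbu, mul_zero, add_zero, Finset.sum_add_distrib, ← Finset.mul_sum]
    rfl
  have hrR : ∑ i, ∑ j, rten a b i j x * y i * u j = Rf a b x y - s0f a b x y := by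
    unfold Rf s0f slow
    rw [← Finset.sum_sub_distrib]
    refine Finset.sum_congr rfl fun i _ => ?_
    rw [Finset.mul_sum, Finset.sum_mul, ← Finset.sum_sub_distrib]
    refine Finset.sum_congr rfl fun j _ => ?_
    rw [hub]; unfold rten sten; ring
  rw [hEu, hrR] at H1
  rw [hr]
  have hne : 1 - bnormsq a b x ≠ 0 := by linarith
  have H4 : Rf a b x y - s0f a b x y + bnormsq a b x * s0f a b x y =
      2 * c * (1 - bnormsq a b x) * (b x ⬝ᵥ y) := by linarith
  field_simp
  linarith

lemma final_iff (hFdef : ∀ x y, F x y = ralpha a x y + rbeta b x y)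
    {U : Set (Vec n)} (hU : IsOpen U) (hx : x ∈ U)
    (h : ∀ x ∈ U, (a x).IsSymm ∧ (a x).PosDef ∧ bnormsq a b x < 1)
    (hda : ∀ i j, DifferentiableAt ℝ (fun z => a z i j) x)
    (hdb : ∀ i, DifferentiableAt ℝ (fun z => b z i) x)
    (hF : ∀ y : Vec n, y ≠ 0 → 0 < F x y ∧ (gmat F x y).det ≠ 0) (c : ℝ) :
    (∀ y : Vec n, y ≠ 0 → SCurv F x y = ((n : ℝ) + 1) * c * F x y) ↔
    (∀ y : Vec n, e00 a b x y = 2 * c * ((ralpha a x y) ^ 2 - (rbeta b x y) ^ 2)) := by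
  obtain ⟨hs, hp, hb⟩ := h x hx
  have hn : ((n:ℝ)+1) ≠ 0 := by positivity
  constructor
  · intro H y
    by_cases hy : y = 0
    · subst hy; simp [e00, ralpha, rbeta]
    have key : ∀ z : Vec n, z ≠ 0 → e00 a b x z = 2 * F x z * (c * F x z +
        (s0f a b x z - Rf a b x z / (1 - bnormsq a b x))) := by
      intro z hz
      have h1 := H z hz
      rw [SCurv_eq hFdef hU hx h hda hdb hF hz, mul_assoc] at h1
      have h2 := mul_left_cancel₀ hn h1
      have h3 := (hF z hz).1
      have h4 : e00 a b x z / (2 * F x z) = c * F x z +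
        (s0f a b x z - Rf a b x z / (1 - bnormsq a b x)) := by linarith
      rw [div_eq_iff (by positivity)] at h4
      linarith
    have hR : Rf a b x ((-1:ℝ) • y) = - Rf a b x y := by
      unfold Rf; rw [← Finset.sum_neg_distrib]
      exact Finset.sum_congr rfl fun i _ => by simp
    have k1 := key y hy
    have k2 := key ((-1:ℝ) • y) (by simpa using hy)
    rw [hFdef, e00_smul, ralpha_smul, rbeta_smul, s0f_smul, hR] at k2
    rw [hFdef] at k1
    have hα := ralpha_pos hp hy
    rw [neg_div] at k2
    simp only [abs_neg, abs_one] at k2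
    generalize Rf a b x y / (1 - bnormsq a b x) = q at *
    have k3 : ralpha a x y * (2 * c * rbeta b x y + (s0f a b x y - q)) = 0 := by linarith
    have k4 := (mul_eq_zero.1 k3).resolve_left hα.ne'
    have k5 : s0f a b x y - q = - (2 * c * rbeta b x y) := by linarith
    rw [k1, k5]; ring
  · intro H y hy
    have h3 := (hF y hy).1
    rw [SCurv_eq hFdef hU hx h hda hdb hF hy, contract hs hp hb H, H]
    rw [hFdef] at h3 ⊢
    field_simp; ring
end Diverg


/-- **Lemma 2.2.** A Randers metric `F = α + β` is of isotropic S-curvature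
`S = (n+1) c(x) F` if and only if `e₀₀ = 2c(x)(α² − β²)`. -/
theorem randers_isotropic_S_curvature_iff_e00
    {n : ℕ} (hn : 2 ≤ n)
    (U : Set (Vec n)) (hUopen : IsOpen U) (hUne : U.Nonempty)
    (a : Vec n → Matrix (Fin n) (Fin n) ℝ) (b : Vec n → Vec n)
    (hRanders : IsRandersOn a b U)
    (F : Vec n → Vec n → ℝ)
    (hFdef : ∀ x y, F x y = ralpha a x y + rbeta b x y)
    (c : Vec n → ℝ) (hc : ContDiffOn ℝ (⊤ : ℕ∞) c U) :
    (∀ x ∈ U, ∀ y : Vec n, y ≠ 0 →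
        SCurv F x y = ((n : ℝ) + 1) * c x * F x y) ↔
    (∀ x ∈ U, ∀ y : Vec n,
        e00 a b x y = 2 * c x * ((ralpha a x y) ^ 2 - (rbeta b x y) ^ 2)) := by
  obtain ⟨hA, hB, h, hFin⟩ := hRanders
  have hFeq : F = fun x y => ralpha a x y + rbeta b x y := by
    funext x y; exact hFdef x y
  rw [← hFeq] at hFin
  have main : ∀ x ∈ U, (∀ y : Vec n, y ≠ 0 → SCurv F x y = ((n : ℝ) + 1) * c x * F x y) ↔
      (∀ y : Vec n, e00 a b x y = 2 * c x * ((ralpha a x y) ^ 2 - (rbeta b x y) ^ 2)) := by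
    intro x hx
    have hU := hUopen.mem_nhds hx
    have hda : ∀ i j, DifferentiableAt ℝ (fun z => a z i j) x := fun i j =>
      ((hA i j).contDiffAt hU).differentiableAt (by simp)
    have hdb0 : DifferentiableAt ℝ b x := (hB.contDiffAt hU).differentiableAt (by simp)
    have hdb : ∀ i, DifferentiableAt ℝ (fun z => b z i) x := fun i =>
      differentiableAt_pi.1 hdb0 i
    exact final_iff hFdef hUopen hx h hda hdb
      (fun y hy => ⟨(hFin.2 x hx y hy).1, (hFin.2 x hx y hy).2.2.det_pos.ne'⟩) (c x)
  exact forall₂_congr main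
end
end

section
/- Let n ≥ 1, let A be a symmetric positive definite n×n real matrix, and let b ∈ ℝⁿ satisfy ⟨b, A⁻¹ b⟩ < 1. Define F : ℝⁿ \ {0} → ℝ by F(y) = √(⟨y, A y⟩) + ⟨b, y⟩ (so F(y) > 0 for y ≠ 0). Fix y ≠ 0 and set α := √(⟨y, A y⟩), β := ⟨b, y⟩, F := α + β, b² := ⟨b, A⁻¹ b⟩, y_i := (A y)_i and b^i := (A⁻¹ b)_i. Let g be the n×n matrix with entries g_{ij} := ½ ∂²(F²)/∂y^i∂y^j evaluated at y. Then g is invertible and its inverse has entries g^{ij} = (α/F)(A⁻¹)^{ij} − (α/F²)(b^i y^j + b^j y^i) + ((b² α + β)/F³) y^i y^j. -/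
open Matrix

noncomputable section

lemma rd_lin {n : ℕ} (c : Vec n) (z : Vec n) :
    HasFDerivAt (fun w : Vec n => ∑ i, c i * w i)
      (∑ i, c i • (ContinuousLinearMap.proj i : Vec n →L[ℝ] ℝ)) z := by
  apply HasFDerivAt.fun_sum
  intro i _
  exact (hasFDerivAt_apply i z).const_mul (c i)

lemma rd_lin_app {n : ℕ} (c : Vec n) (k : Fin n) :
    (∑ i, c i • (ContinuousLinearMap.proj i : Vec n →L[ℝ] ℝ)) (Pi.single k 1) = c k := by
  simp [Pi.single_apply]

lemma rd_quad {n : ℕ} (A : Matrix (Fin n) (Fin n) ℝ) (hA : A.IsSymm) (z : Vec n) :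
    HasFDerivAt (fun w : Vec n => ∑ i, ∑ j, A i j * w i * w j)
      (∑ i, (2 * ∑ j, A i j * z j) • (ContinuousLinearMap.proj i : Vec n →L[ℝ] ℝ)) z := by
  have h : HasFDerivAt (fun w : Vec n => ∑ i, w i * ∑ j, A i j * w j)
      (∑ i, (z i • (∑ j, A i j • (ContinuousLinearMap.proj j : Vec n →L[ℝ] ℝ)) +
        (∑ j, A i j * z j) • (ContinuousLinearMap.proj i : Vec n →L[ℝ] ℝ))) z := by
    apply HasFDerivAt.fun_sum
    intro i _
    exact (hasFDerivAt_apply i z).mul (rd_lin (A i) z)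
  have e : (fun w : Vec n => ∑ i, ∑ j, A i j * w i * w j) =
      fun w : Vec n => ∑ i, w i * ∑ j, A i j * w j := by
    funext w
    refine Finset.sum_congr rfl fun i _ => ?_
    rw [Finset.mul_sum]
    refine Finset.sum_congr rfl fun j _ => ?_
    ring
  rw [e]
  refine h.congr_fderiv ?_
  ext v
  simp only [_root_.sum_apply, _root_.add_apply,
    _root_.smul_apply, ContinuousLinearMap.proj_apply, smul_eq_mul,
    Finset.sum_add_distrib]
  have : ∑ i, z i * ∑ j, A i j * v j = ∑ i, (∑ j, A i j * z j) * v i := by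
    simp only [Finset.mul_sum, Finset.sum_mul]
    rw [Finset.sum_comm]
    refine Finset.sum_congr rfl fun i _ => Finset.sum_congr rfl fun j _ => ?_
    rw [hA.apply i j]; ring
  rw [this, ← Finset.sum_add_distrib]
  refine Finset.sum_congr rfl fun i _ => ?_
  ring

lemma rd_pos {n : ℕ} (A : Matrix (Fin n) (Fin n) ℝ) (hA : A.PosDef) (z : Vec n) (hz : z ≠ 0) :
    0 < ∑ i, ∑ j, A i j * z i * z j := by
  have h := hA.dotProduct_mulVec_pos hz
  have e : star z ⬝ᵥ A *ᵥ z = ∑ i, ∑ j, A i j * z i * z j := by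
    simp only [dotProduct, mulVec, Finset.mul_sum, Pi.star_apply, star_trivial]
    refine Finset.sum_congr rfl fun i _ => Finset.sum_congr rfl fun j _ => ?_
    ring
  rwa [e] at h

lemma rd_F {n : ℕ} (A : Matrix (Fin n) (Fin n) ℝ) (hAs : A.IsSymm) (hA : A.PosDef) (b z : Vec n)
    (hz : z ≠ 0) : HasFDerivAt
      (fun w : Vec n => Real.sqrt (∑ i, ∑ j, A i j * w i * w j) + ∑ i, b i * w i)
      (∑ i, ((∑ j, A i j * z j) / Real.sqrt (∑ i, ∑ j, A i j * z i * z j) + b i) •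
        (ContinuousLinearMap.proj i : Vec n →L[ℝ] ℝ)) z := by
  have hp := rd_pos A hA z hz
  refine (((rd_quad A hAs z).sqrt hp.ne').add (rd_lin b z)).congr_fderiv ?_
  ext v
  simp only [_root_.sum_apply, _root_.add_apply,
    _root_.smul_apply, ContinuousLinearMap.proj_apply, smul_eq_mul,
    Finset.mul_sum, ← Finset.sum_add_distrib]
  have := (Real.sqrt_pos.2 hp).ne'
  refine Finset.sum_congr rfl fun i _ => ?_
  rw [← Finset.mul_sum]
  field_simp

lemma rd_g {n : ℕ} (A : Matrix (Fin n) (Fin n) ℝ) (hAs : A.IsSymm) (hA : A.PosDef) (b y : Vec n)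
    (hy : y ≠ 0) (F : Vec n → ℝ)
    (hF : ∀ z : Vec n, F z = Real.sqrt (∑ i, ∑ j, A i j * z i * z j) + ∑ i, b i * z i)
    (α : ℝ) (hα : α = Real.sqrt (∑ i, ∑ j, A i j * y i * y j)) (i j : Fin n) :
    (1 / 2) * pd i (fun z => pd j (fun w => (F w) ^ 2) z) y =
      (F y / α) * A i j - (F y / α ^ 3) * (∑ k, A i k * y k) * (∑ k, A j k * y k)
      + ((∑ k, A i k * y k) / α + b i) * ((∑ k, A j k * y k) / α + b j) := by
  have hFe : F = fun w : Vec n => Real.sqrt (∑ i, ∑ j, A i j * w i * w j) + ∑ i, b i * w i :=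
    funext hF
  have hF' := fun z hz => rd_F A hAs hA b z hz
  rw [← hFe] at hF'
  have h1 : ∀ z : Vec n, z ≠ 0 → pd j (fun w => (F w) ^ 2) z =
      2 * F z * ((∑ k, A j k * z k) / Real.sqrt (∑ i, ∑ j, A i j * z i * z j) + b j) := by
    intro z hz
    have h := (hF' z hz).pow 2
    unfold pd
    rw [h.fderiv, _root_.smul_apply, rd_lin_app
      (fun i => (∑ j, A i j * z j) / Real.sqrt (∑ i, ∑ j, A i j * z i * z j) + b i)]
    simp
  have hev : (fun z => pd j (fun w => (F w) ^ 2) z) =ᶠ[nhds y] fun z =>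
      2 * F z * ((∑ k, A j k * z k) / Real.sqrt (∑ i, ∑ j, A i j * z i * z j) + b j) := by
    filter_upwards [isOpen_ne.mem_nhds hy] with z hz using h1 z hz
  have hp := rd_pos A hA y hy
  have hs := Real.sqrt_pos.2 hp
  have hd := ((hF' y hy).const_mul 2).mul
    (((rd_lin (A j) y).mul
      ((hasDerivAt_inv hs.ne').comp_hasFDerivAt y ((rd_quad A hAs y).sqrt hp.ne'))).add_const (b j))
  have hq := rd_lin_app (fun i => (∑ j, A i j * y j) / Real.sqrt (∑ i, ∑ j, A i j * y i * y j) + b i) i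
  have hq2 := rd_lin_app (fun i => 2 * (∑ j, A i j * y j)) i
  have hq3 := rd_lin_app (A j) i
  unfold pd at hev ⊢
  rw [hev.fderiv_eq]
  simp only [div_eq_mul_inv _ (Real.sqrt _)]
  erw [hd.fderiv]
  simp only [ContinuousLinearMap.add_apply, ContinuousLinearMap.sub_apply,
    _root_.smul_apply, smul_eq_mul, hq, hq2, hq3, Function.comp_apply, Pi.mul_apply]
  rw [← hα] at hs ⊢
  rw [hAs.apply i j]
  field_simp
  ring

/-- **Formula (2.8).** The inverse of the fundamental tensor of the Randers norm
`F(y) = √⟨y, Ay⟩ + ⟨b, y⟩` at a fixed `y ≠ 0` is given by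
`g^{ij} = (α/F) (A⁻¹)^{ij} − (α/F²)(bⁱyʲ + bʲyⁱ) + ((b²α + β)/F³) yⁱyʲ`,
where `bⁱ = (A⁻¹b)ⁱ`. -/
theorem randers_inverse_fundamental_tensor
    {n : ℕ} (hn : 1 ≤ n)
    (A : Matrix (Fin n) (Fin n) ℝ) (hAsymm : A.IsSymm) (hApos : A.PosDef)
    (b : Vec n) (hb : ∑ i, b i * (A⁻¹).mulVec b i < 1)
    (F : Vec n → ℝ)
    (hF : ∀ z : Vec n, F z = Real.sqrt (∑ i, ∑ j, A i j * z i * z j) + ∑ i, b i * z i)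
    (y : Vec n) (hy : y ≠ 0)
    (α β Fv b2 : ℝ)
    (hα : α = Real.sqrt (∑ i, ∑ j, A i j * y i * y j))
    (hβ : β = ∑ i, b i * y i)
    (hFv : Fv = α + β)
    (hb2 : b2 = ∑ i, b i * (A⁻¹).mulVec b i)
    (g : Matrix (Fin n) (Fin n) ℝ)
    (hg : ∀ i j, g i j = (1 / 2) * pd i (fun z => pd j (fun w => (F w) ^ 2) z) y) :
    IsUnit g ∧
    ∀ i j, g⁻¹ i j =
      (α / Fv) * A⁻¹ i j
        - (α / Fv ^ 2) * ((A⁻¹).mulVec b i * y j + (A⁻¹).mulVec b j * y i)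
        + ((b2 * α + β) / Fv ^ 3) * y i * y j := by
  have hp := rd_pos A hApos y hy
  have hαpos : 0 < α := hα ▸ Real.sqrt_pos.2 hp
  have hα2 : ∑ i, ∑ j, A i j * y i * y j = α ^ 2 := by rw [hα, Real.sq_sqrt hp.le]
  have hFy : F y = Fv := by rw [hF, hFv, hα, hβ]
  have hdet : IsUnit A.det := hApos.det_pos.ne'.isUnit
  obtain ⟨B, hB⟩ : ∃ B, B = A⁻¹ *ᵥ b := ⟨_, rfl⟩
  obtain ⟨u, hu⟩ : ∃ u, u = A *ᵥ y := ⟨_, rfl⟩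
  have hui : ∀ i, ∑ k, A i k * y k = u i := fun i => by rw [hu]; rfl
  have hAB : A *ᵥ B = b := by rw [hB, mulVec_mulVec, mul_nonsing_inv _ hdet, one_mulVec]
  have hABi : ∀ i, ∑ k, A i k * B k = b i := fun i => congrFun hAB i
  have hIs : ∀ i j, A⁻¹ i j = A⁻¹ j i := by
    intro i j
    have : (A⁻¹)ᵀ = A⁻¹ := by rw [transpose_nonsing_inv, hAsymm.eq]
    exact congrFun (congrFun this j) i
  have hIu : ∀ j, ∑ k, u k * A⁻¹ k j = y j := by
    intro j
    have : A⁻¹ *ᵥ u = y := by rw [hu, mulVec_mulVec, nonsing_inv_mul _ hdet, one_mulVec]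
    rw [← congrFun this j]
    exact Finset.sum_congr rfl fun k _ => by rw [hIs k j, mul_comm]
  have hIb : ∀ j, ∑ k, b k * A⁻¹ k j = B j := by
    intro j
    rw [hB]
    exact Finset.sum_congr rfl fun k _ => by rw [hIs k j, mul_comm]
  have huy : ∑ k, u k * y k = α ^ 2 := by
    rw [← hα2]
    refine Finset.sum_congr rfl fun i _ => ?_
    rw [← hui, Finset.sum_mul]
    exact Finset.sum_congr rfl fun k _ => by ring
  have huB : ∑ k, u k * B k = β := by
    rw [hβ]
    simp only [← hui, ← hABi, Finset.sum_mul]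
    rw [Finset.sum_comm]
    refine Finset.sum_congr rfl fun i _ => Finset.sum_congr rfl fun j _ => ?_
    rw [hAsymm.apply i j]; ring
  rw [← hB] at hb hb2 ⊢
  have hAI : ∀ i j, ∑ k, A i k * A⁻¹ k j = (1 : Matrix (Fin n) (Fin n) ℝ) i j := by
    intro i j
    rw [← mul_nonsing_inv _ hdet, mul_apply]
  have hcs : β ^ 2 ≤ α ^ 2 * b2 := by
    have h := hApos.posSemidef.dotProduct_mulVec_nonneg (α ^ 2 • B - β • y)
    have e : star (α ^ 2 • B - β • y) ⬝ᵥ A *ᵥ (α ^ 2 • B - β • y)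
        = α ^ 2 * (α ^ 2 * b2 - β ^ 2) := by
      rw [mulVec_sub, mulVec_smul, mulVec_smul, hAB, ← hu, star_trivial]
      have e1 : B ⬝ᵥ b = b2 := by rw [dotProduct_comm, hb2]; rfl
      have e2 : y ⬝ᵥ b = β := by rw [dotProduct_comm, hβ]; rfl
      have e3 : B ⬝ᵥ u = β := by rw [dotProduct_comm, ← huB]; rfl
      have e4 : y ⬝ᵥ u = α ^ 2 := by rw [dotProduct_comm, ← huy]; rfl
      simp only [sub_dotProduct, dotProduct_sub, smul_dotProduct, dotProduct_smul, smul_eq_mul,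
        e1, e2, e3, e4]
      ring
    rw [e] at h
    have := nonneg_of_mul_nonneg_right h (by positivity)
    linarith
  have hFpos : 0 < Fv := by
    rw [← hb2] at hb
    have : β ^ 2 < α ^ 2 := by nlinarith [sq_pos_of_pos hαpos]
    have := (abs_lt_of_sq_lt_sq' this hαpos.le).1
    linarith
  have hgm : g * Matrix.of (fun i j => (α / Fv) * A⁻¹ i j
        - (α / Fv ^ 2) * (B i * y j + B j * y i)
        + ((b2 * α + β) / Fv ^ 3) * y i * y j) = 1 := by
    ext i j
    rw [mul_apply]
    simp only [of_apply]
    have hgi : ∀ k, g i k = (Fv / α) * A i k - (Fv / α ^ 3) * u i * u k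
        + (u i / α + b i) * (u k / α + b k) := by
      intro k
      rw [hg, rd_g A hAsymm hApos b y hy F hF α hα, hFy, hui, hui]
    simp only [hgi]
    obtain ⟨m, hm⟩ : ∃ m, m = (b2 * α + β) / Fv ^ 3 := ⟨_, rfl⟩
    obtain ⟨t, ht⟩ : ∃ t, t = α / Fv ^ 2 := ⟨_, rfl⟩
    obtain ⟨s, hs⟩ : ∃ s, s = α / Fv := ⟨_, rfl⟩
    obtain ⟨p, hpp⟩ : ∃ p, p = Fv / α := ⟨_, rfl⟩
    obtain ⟨c, hc⟩ : ∃ c, c = (u i / α + b i) / α - Fv / α ^ 3 * u i := ⟨_, rfl⟩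
    obtain ⟨d, hd⟩ : ∃ d, d = u i / α + b i := ⟨_, rfl⟩
    have key : ∑ k, ((Fv / α) * A i k - (Fv / α ^ 3) * u i * u k
        + (u i / α + b i) * (u k / α + b k)) * ((α / Fv) * A⁻¹ k j
        - (α / Fv ^ 2) * (B k * y j + B j * y k)
        + ((b2 * α + β) / Fv ^ 3) * y k * y j)
      = p * (s * (∑ k, A i k * A⁻¹ k j) - t * ((∑ k, A i k * B k) * y j + B j * ∑ k, A i k * y k)
          + m * (∑ k, A i k * y k) * y j)
        + c * (s * (∑ k, u k * A⁻¹ k j) - t * ((∑ k, u k * B k) * y j + B j * ∑ k, u k * y k)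
          + m * (∑ k, u k * y k) * y j)
        + d * (s * (∑ k, b k * A⁻¹ k j) - t * ((∑ k, b k * B k) * y j + B j * ∑ k, b k * y k)
          + m * (∑ k, b k * y k) * y j) := by
      simp only [Finset.mul_sum, Finset.sum_mul, ← Finset.sum_add_distrib,
        ← Finset.sum_sub_distrib]
      refine Finset.sum_congr rfl fun k _ => ?_
      rw [← hm, ← ht, ← hs, ← hpp, hc, ← hd]
      ring
    rw [key, hAI, hABi, hui, hIu, huB, huy, hIb, ← hb2, ← hβ, hm, ht, hs, hpp, hc, hd]
    have hβ' : β = Fv - α := by linarith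
    rw [hβ']
    field_simp
    ring
  refine ⟨IsUnit.of_mul_eq_one _ hgm, ?_⟩
  intro i j
  rw [inv_eq_right_inv hgm]
  rfl
end
end

section
/- Let n ≥ 2. Let Q ∈ ℝ[y¹,…,yⁿ] be homogeneous of degree 2 with Q(v) > 0 for all v ∈ ℝⁿ \ {0}, let L ∈ ℝ[y¹,…,yⁿ] be homogeneous of degree 1 with L ≠ 0, and let E ∈ ℝ[y¹,…,yⁿ] be homogeneous of degree 2. If Q divides L·E² in ℝ[y¹,…,yⁿ], then there exists a constant c ∈ ℝ such that E = c·Q. -/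
open MvPolynomial in
lemma lin_form_zero {n : ℕ} (hn : 2 ≤ n) (a : MvPolynomial (Fin n) ℝ) (ha : a.IsHomogeneous 1) :
    ∃ v : Fin n → ℝ, v ≠ 0 ∧ eval v a = 0 := by
  have h1 : ∃ f : (Fin n → ℝ) →ₗ[ℝ] ℝ, ∀ v, eval v a = f v := by
    have hm : a ∈ homogeneousSubmodule (Fin n) ℝ 1 := ha
    rw [homogeneousSubmodule_one_eq_span_X] at hm
    induction hm using Submodule.span_induction with
    | mem x hx =>
      obtain ⟨i, rfl⟩ := hx
      exact ⟨LinearMap.proj i, fun v => by simp⟩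
    | zero => exact ⟨0, fun v => by simp⟩
    | add x y hx hy ihx ihy =>
      have key : ∀ z ∈ Submodule.span ℝ (Set.range (X : Fin n → MvPolynomial (Fin n) ℝ)),
          z.IsHomogeneous 1 := by
        intro z hz
        rw [← homogeneousSubmodule_one_eq_span_X] at hz
        exact hz
      obtain ⟨f, hf⟩ := ihx (key x hx)
      obtain ⟨g, hg⟩ := ihy (key y hy)
      exact ⟨f + g, fun v => by simp [hf, hg]⟩
    | smul r x hx ihx =>
      rw [← homogeneousSubmodule_one_eq_span_X] at hx
      obtain ⟨f, hf⟩ := ihx hx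
      exact ⟨r • f, fun v => by simp [hf]⟩
  obtain ⟨f, hf⟩ := h1
  have hk : LinearMap.ker f ≠ ⊥ := LinearMap.ker_ne_bot_of_finrank_lt (by simp; omega)
  obtain ⟨v, hv, hv0⟩ := Submodule.exists_mem_ne_zero_of_ne_bot hk
  exact ⟨v, hv0, by rw [hf]; exact hv⟩

open MvPolynomial in
lemma isHom_one_of {n : ℕ} (a : MvPolynomial (Fin n) ℝ) (ha : a.totalDegree = 1)
    (h0 : eval 0 a = 0) : a.IsHomogeneous 1 := by
  rw [eval_zero, constantCoeff_eq] at h0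
  intro d hd
  have h1 := le_totalDegree (mem_support_iff.mpr hd)
  have h2 : d ≠ 0 := by rintro rfl; exact hd h0
  have h3 : d.degree ≠ 0 := by rwa [Ne, Finsupp.degree_eq_zero_iff]
  have h4 : d.degree ≤ 1 := by rw [← ha]; exact h1
  have h5 : Finsupp.weight 1 d = d.degree :=
    (DFunLike.congr_fun (Finsupp.degree_eq_weight_one (R := ℕ) (σ := Fin n)) d).symm
  rw [h5]
  omega

open MvPolynomial in
lemma posdef_irreducible {n : ℕ} (hn : 2 ≤ n)
    (Q : MvPolynomial (Fin n) ℝ) (hQhom : Q.IsHomogeneous 2) (hQ0 : Q ≠ 0)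
    (hQpos : ∀ v : Fin n → ℝ, v ≠ 0 → 0 < MvPolynomial.eval v Q) : Irreducible Q := by
  have hdeg := hQhom.totalDegree hQ0
  have hno : ∀ a b : MvPolynomial (Fin n) ℝ, Q = a * b → a.totalDegree = 1 → eval 0 a ≠ 0 := by
    intro a b hab ha h0
    obtain ⟨v, hv, hva⟩ := lin_form_zero hn a (isHom_one_of a ha h0)
    have := hQpos v hv
    rw [hab, map_mul, hva, zero_mul] at this
    exact lt_irrefl _ this
  have hu : ∀ a : MvPolynomial (Fin n) ℝ, a ≠ 0 → a.totalDegree = 0 → IsUnit a := by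
    intro a ha h
    rw [totalDegree_eq_zero_iff_eq_C] at h
    rw [h] at ha ⊢
    exact (IsUnit.mk0 _ (by intro h; rw [h] at ha; simp at ha)).map C
  constructor
  · intro h
    rw [isUnit_iff_totalDegree_of_isReduced] at h
    omega
  · intro a b hab
    have ha : a ≠ 0 := by rintro rfl; simp [hab] at hQ0
    have hb : b ≠ 0 := by rintro rfl; simp [hab] at hQ0
    have hd := totalDegree_mul_of_isDomain ha hb
    rw [← hab, hdeg] at hd
    rcases Nat.eq_zero_or_pos a.totalDegree with h | h
    · exact Or.inl (hu a ha h)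
    rcases Nat.eq_zero_or_pos b.totalDegree with h' | h'
    · exact Or.inr (hu b hb h')
    exfalso
    have h1 := hno a b hab (by omega)
    have h2 := hno b a (by rw [hab, mul_comm]) (by omega)
    have h3 : eval 0 Q = 0 := by
      rw [eval_zero, constantCoeff_eq]
      exact hQhom.coeff_eq_zero (by simp)
    rw [hab, map_mul] at h3
    exact (mul_ne_zero h1 h2) h3

/-- **Divisibility step (4.11) ⟹ (4.12).** If a positive definite quadratic form
`Q` divides `L·E²`, where `L ≠ 0` is linear and `E` is quadratic, then `E` is a
constant multiple of `Q`. -/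
theorem quadratic_divides_linear_times_square
    {n : ℕ} (hn : 2 ≤ n)
    (Q : MvPolynomial (Fin n) ℝ) (hQhom : Q.IsHomogeneous 2)
    (hQpos : ∀ v : Fin n → ℝ, v ≠ 0 → 0 < MvPolynomial.eval v Q)
    (L : MvPolynomial (Fin n) ℝ) (hLhom : L.IsHomogeneous 1) (hL : L ≠ 0)
    (E : MvPolynomial (Fin n) ℝ) (hEhom : E.IsHomogeneous 2)
    (hdvd : Q ∣ L * E ^ 2) :
    ∃ c : ℝ, E = MvPolynomial.C c * Q := by
  have hQ0 : Q ≠ 0 := by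
    rintro rfl
    have := hQpos (fun _ => 1) (fun h => one_ne_zero (congrFun h ⟨0, by omega⟩))
    simp at this
  have hp : Prime Q := (posdef_irreducible hn Q hQhom hQ0 hQpos).prime
  have hdeg := hQhom.totalDegree hQ0
  rcases hp.dvd_or_dvd hdvd with ⟨b, h⟩ | h
  · exfalso
    have hb : b ≠ 0 := by rintro rfl; simp [h] at hL
    have hd := MvPolynomial.totalDegree_mul_of_isDomain hQ0 hb
    rw [← h, hdeg, hLhom.totalDegree hL] at hd
    omega
  · obtain ⟨b, h⟩ := hp.dvd_of_dvd_pow h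
    by_cases hE : E = 0
    · exact ⟨0, by simp [hE]⟩
    have hb : b ≠ 0 := by rintro rfl; simp [h] at hE
    have hd := MvPolynomial.totalDegree_mul_of_isDomain hQ0 hb
    rw [← h, hdeg, hEhom.totalDegree hE] at hd
    have hb0 : b.totalDegree = 0 := by omega
    rw [MvPolynomial.totalDegree_eq_zero_iff_eq_C] at hb0
    exact ⟨_, by rw [← hb0, h, mul_comm]⟩
end

section
/- Let n ≥ 2. Let Q ∈ ℝ[y¹,…,yⁿ] be homogeneous of degree 2 with Q(v) > 0 for all v ∈ ℝⁿ \ {0}, and let P₁, P₂ ∈ ℝ[y¹,…,yⁿ] be polynomials such that P₁(v) + √(Q(v)) · P₂(v) = 0 for every v ∈ ℝⁿ. Then P₁ = 0 and P₂ = 0. -/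
theorem ris_eval_smul {n : ℕ} (Q : MvPolynomial (Fin n) ℝ) (hQ : Q.IsHomogeneous 2)
    (c : ℝ) (x : Fin n → ℝ) :
    MvPolynomial.eval (fun i => c * x i) Q = c ^ 2 * MvPolynomial.eval x Q := by
  rw [MvPolynomial.eval_eq', MvPolynomial.eval_eq', Finset.mul_sum]
  refine Finset.sum_congr rfl fun d hd => ?_
  have h2 : ∑ i, d i = 2 := by
    have := hQ (MvPolynomial.mem_support_iff.1 hd)
    rw [Finsupp.weight_apply, Finsupp.sum_fintype] at this <;> simpa using this
  simp_rw [mul_pow, Finset.prod_mul_distrib, Finset.prod_pow_eq_pow_sum, h2]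
  ring

theorem ris_parity (q a b : Polynomial ℝ) (hq : Prime q) (h : a ^ 2 = q * b ^ 2) : b = 0 := by
  by_contra hb
  have hq0 := hq.ne_zero
  have hr : q * b ^ 2 ≠ 0 := mul_ne_zero hq0 (pow_ne_zero _ hb)
  have ha : a ≠ 0 := by
    rintro rfl
    apply hr
    rw [← h]; simp
  have e := congrArg (multiplicity q) h
  rw [multiplicity_mul hq (.of_prime_left hq hr),
    FiniteMultiplicity.multiplicity_pow hq (.of_prime_left hq ha),
    FiniteMultiplicity.multiplicity_pow hq (.of_prime_left hq hb), multiplicity_self] at e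
  omega

noncomputable def risLine {n : ℕ} (v w : Fin n → ℝ) (P : MvPolynomial (Fin n) ℝ) :
    Polynomial ℝ :=
  MvPolynomial.aeval (fun i => Polynomial.C (v i) + Polynomial.C (w i) * Polynomial.X) P

theorem risLine_eval {n : ℕ} (v w : Fin n → ℝ) (P : MvPolynomial (Fin n) ℝ) (t : ℝ) :
    (risLine v w P).eval t = MvPolynomial.eval (fun i => v i + w i * t) P := by
  unfold risLine
  induction P using MvPolynomial.induction_on with
  | C a => simp
  | add p q hp hq => simp [hp, hq]
  | mul_X p i hp => simp [hp]

theorem ris_vanish {n : ℕ}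
    (Q : MvPolynomial (Fin n) ℝ) (hQhom : Q.IsHomogeneous 2)
    (hQpos : ∀ v : Fin n → ℝ, v ≠ 0 → 0 < MvPolynomial.eval v Q)
    (P₁ P₂ : MvPolynomial (Fin n) ℝ)
    (h : ∀ v : Fin n → ℝ,
      MvPolynomial.eval v P₁ + Real.sqrt (MvPolynomial.eval v Q) * MvPolynomial.eval v P₂ = 0)
    (v : Fin n → ℝ) (i j : Fin n) (hij : i ≠ j) (hv : v i ≠ 0) :
    MvPolynomial.eval v P₂ = 0 := by
  set w : Fin n → ℝ := Pi.single j 1 with hw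
  have hwi : w i = 0 := by simp [hw, hij]
  have hw0 : w ≠ 0 := fun hz => by simpa [hw] using congrFun hz j
  have hline : ∀ t : ℝ, 0 < (risLine v w Q).eval t := fun t => by
    rw [risLine_eval]
    exact hQpos _ fun hz => hv (by simpa [hwi] using congrFun hz i)
  have hdeg : (risLine v w Q).natDegree ≤ 2 := by
    refine MvPolynomial.aeval_natDegree_le (m := 2) (n := 1) Q hQhom.totalDegree_le _ fun i => ?_
    compute_degree
  have hdeg1 : (risLine v w Q).natDegree ≠ 0 := by
    intro h0
    obtain ⟨c, hc⟩ := Polynomial.natDegree_eq_zero.1 h0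
    have key : Polynomial.X * (risLine w v Q - Polynomial.C c * Polynomial.X ^ 2) = 0 := by
      refine Polynomial.funext fun s => ?_
      by_cases hs : s = 0
      · simp [hs]
      have e : (risLine w v Q).eval s = s ^ 2 * c := by
        have e1 : (risLine v w Q).eval s⁻¹ = c := by rw [← hc]; simp
        rw [risLine_eval] at e1
        rw [risLine_eval, ← e1, ← ris_eval_smul Q hQhom]
        congr 2
        funext k
        field_simp
        ring
      rw [Polynomial.eval_mul, Polynomial.eval_sub, e]
      simp
      right
      ring
    have k2 := (mul_eq_zero.1 key).resolve_left Polynomial.X_ne_zero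
    have k3 := congrArg (Polynomial.eval 0) k2
    simp [risLine_eval] at k3
    exact (hQpos w hw0).ne' k3
  have hirr : Irreducible (risLine v w Q) := by
    apply Polynomial.irreducible_of_degree_le_three_of_not_isRoot
    · rw [Finset.mem_Icc]; omega
    · exact fun x hx => (hline x).ne' hx
  have hb := ris_parity _ (risLine v w P₁) (risLine v w P₂) hirr.prime (by
    refine Polynomial.funext fun t => ?_
    have ht := hline t
    rw [Polynomial.eval_mul, Polynomial.eval_pow, Polynomial.eval_pow]
    rw [risLine_eval] at ht
    simp only [risLine_eval]
    have e := h (fun i => v i + w i * t)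
    rw [eq_neg_of_add_eq_zero_left e, neg_sq, mul_pow, Real.sq_sqrt ht.le])
  have := congrArg (Polynomial.eval 0) hb
  simpa [risLine_eval] using this


/-- **Rational/irrational part separation.** If `Q` is a positive definite
quadratic form and `P₁ + √Q · P₂ = 0` holds pointwise on ℝⁿ, then `P₁ = 0` and
`P₂ = 0`. -/
theorem rational_irrational_separation
    {n : ℕ} (hn : 2 ≤ n)
    (Q : MvPolynomial (Fin n) ℝ) (hQhom : Q.IsHomogeneous 2)
    (hQpos : ∀ v : Fin n → ℝ, v ≠ 0 → 0 < MvPolynomial.eval v Q)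
    (P₁ P₂ : MvPolynomial (Fin n) ℝ)
    (h : ∀ v : Fin n → ℝ,
      MvPolynomial.eval v P₁ + Real.sqrt (MvPolynomial.eval v Q) * MvPolynomial.eval v P₂ = 0) :
    P₁ = 0 ∧ P₂ = 0 := by
  have h2 : P₂ = 0 := by
    let i : Fin n := ⟨0, by omega⟩
    let j : Fin n := ⟨1, by omega⟩
    have hij : i ≠ j := by simp [i, j]
    have hX : MvPolynomial.X i * P₂ = 0 := by
      refine MvPolynomial.funext fun v => ?_
      by_cases hv : v i = 0
      · simp [hv]
      · simp [ris_vanish Q hQhom hQpos P₁ P₂ h v i j hij hv]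
    exact (mul_eq_zero.1 hX).resolve_left (MvPolynomial.X_ne_zero i)
  refine ⟨MvPolynomial.funext fun v => ?_, h2⟩
  simpa [h2] using h v
end
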